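/- Let H be a finite group with normal subgroup Q which is similar to a 3-centralizer in a group of type F₂, and write Z = Z(Q). Then the conjugation action of H on the set Q ∖ Z has exactly two orbits; i.e., there are exactly two H-conjugacy classes of elements in Q ∖ Z. -/

import Mathlib

/-- `O_p(X)`: the largest normal `p`-subgroup of the group `X` (for finite `X` this is the
`p`-core), defined as the join of all normal `p`-subgroups. -/
def Op (p : ℕ) (X : Type*) [Group X] : Subgroup X :=
  sSup {P : Subgroup X | P.Normal ∧ IsPGroup p P}

theorem map_conjAut_eq_of_normal {X : Type*} [Group X] (g : X) {P : Subgroup X}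
    (hP : P.Normal) : Subgroup.map (MulAut.conj g).toMonoidHom P = P := by
  ext x
  simp only [Subgroup.mem_map, MulEquiv.coe_toMonoidHom, MulAut.conj_apply]
  constructor
  · rintro ⟨y, hy, rfl⟩
    exact hP.conj_mem y hy g
  · intro hx
    refine ⟨g⁻¹ * x * g, by simpa using hP.conj_mem x hx g⁻¹, by group⟩

instance Op.normal (p : ℕ) (X : Type*) [Group X] : (Op p X).Normal := by
  constructor
  intro n hn g
  have key : Subgroup.map (MulAut.conj g).toMonoidHom (Op p X) = Op p X := by
    unfold Op
    rw [(Subgroup.gc_map_comap _).l_sSup]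
    apply le_antisymm
    · refine iSup_le fun P => iSup_le fun hP => ?_
      rw [map_conjAut_eq_of_normal g hP.1]
      exact le_sSup hP
    · refine sSup_le fun P hP => ?_
      refine le_trans (le_of_eq (map_conjAut_eq_of_normal g hP.1).symm) ?_
      exact le_iSup₂_of_le P hP le_rfl
  rw [← key]
  exact Subgroup.mem_map.mpr ⟨n, hn, by simp⟩

/-- A finite `p`-group is extraspecial if its center, derived subgroup and Frattini subgroup
coincide and have order `p`. -/
def IsExtraspecial (p : ℕ) (P : Type*) [Group P] : Prop :=
  IsPGroup p P ∧ Subgroup.center P = commutator P ∧ Subgroup.center P = frattini P ∧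
    Nat.card (Subgroup.center P) = p

/-- The symplectic group `Sp₄(GF(3))`. -/
abbrev Sp43 := Matrix.symplecticGroup (Fin 2) (ZMod 3)

/-- `PSp₄(3) ≅ Ω₆⁻(2)`, the quotient of `Sp₄(GF(3))` by its center. -/
abbrev PSp43 := Sp43 ⧸ Subgroup.center Sp43

/-- A finite group `H` with a normal subgroup `Q` is similar to a 3-centralizer in a group of
type `M(23)` or `F₂` (Definitions 1.1 and 1.2 of the paper): `Q = F*(H) = O₃(H) ≅ 3^{1+8}_+`
with `Z(Q) = Z(H)`, `O₂(H/Q) ≅ 2^{1+6}_-` with `F*(H/Q) = O₂(H/Q)`, and `(H/Q)/O₂(H/Q)` is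
isomorphic to `PSp₄(3)` (type `F₂`) or to the centralizer of a 3-central element of `PSp₄(3)`
(type `M(23)`). -/
structure SimilarToM23orF2Centralizer (H : Type*) [Group H] [Finite H]
    (Q : Subgroup H) [Q.Normal] : Prop where
  extraspecial : IsExtraspecial 3 Q
  card_eq : Nat.card Q = 3 ^ 9
  exponent3 : ∀ x ∈ Q, x ^ 3 = 1
  centralizer_eq : Subgroup.centralizer (Q : Set H) = Subgroup.center H
  center_le : Subgroup.center H ≤ Q
  O2_extraspecial : IsExtraspecial 2 (Op 2 (H ⧸ Q))
  O2_card : Nat.card (Op 2 (H ⧸ Q)) = 2 ^ 7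
  O2_minusType : ∀ A : Subgroup (H ⧸ Q), A ≤ Op 2 (H ⧸ Q) → (∀ x ∈ A, x ^ 2 = 1) →
    Nat.card A ≤ 2 ^ 3
  O2_selfCentralizing :
    Subgroup.centralizer ((Op 2 (H ⧸ Q)) : Set (H ⧸ Q)) ≤ Op 2 (H ⧸ Q)
  quotient_iso :
    Nonempty (((H ⧸ Q) ⧸ Op 2 (H ⧸ Q)) ≃* PSp43) ∨
    ∃ (z : PSp43) (S : Sylow 3 PSp43), orderOf z = 3 ∧ z ∈ (S : Subgroup PSp43) ∧
      z ∈ Subgroup.centralizer ((S : Subgroup PSp43) : Set PSp43) ∧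
      Nonempty (((H ⧸ Q) ⧸ Op 2 (H ⧸ Q)) ≃* Subgroup.centralizer {z})

/-- A finite group `H` with a normal subgroup `Q` is similar to a 3-centralizer in a group of
type `F₂` (Definition 1.2 of the paper). -/
structure SimilarToF2Centralizer (H : Type*) [Group H] [Finite H]
    (Q : Subgroup H) [Q.Normal] : Prop where
  extraspecial : IsExtraspecial 3 Q
  card_eq : Nat.card Q = 3 ^ 9
  exponent3 : ∀ x ∈ Q, x ^ 3 = 1
  centralizer_eq : Subgroup.centralizer (Q : Set H) = Subgroup.center H
  center_le : Subgroup.center H ≤ Q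
  O2_extraspecial : IsExtraspecial 2 (Op 2 (H ⧸ Q))
  O2_card : Nat.card (Op 2 (H ⧸ Q)) = 2 ^ 7
  O2_minusType : ∀ A : Subgroup (H ⧸ Q), A ≤ Op 2 (H ⧸ Q) → (∀ x ∈ A, x ^ 2 = 1) →
    Nat.card A ≤ 2 ^ 3
  O2_selfCentralizing :
    Subgroup.centralizer ((Op 2 (H ⧸ Q)) : Set (H ⧸ Q)) ≤ Op 2 (H ⧸ Q)
  quotient_iso : Nonempty (((H ⧸ Q) ⧸ Op 2 (H ⧸ Q)) ≃* PSp43)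


theorem x17_orb_dvd {K α : Type*} [Group K] [MulAction K α] [Finite α] (d : ℕ) (s : Set α)
    (hs : ∀ g : K, ∀ a ∈ s, g • a ∈ s)
    (h : ∀ a ∈ s, d ∣ (MulAction.orbit K a).ncard) : d ∣ s.ncard := by
  induction hn : s.ncard using Nat.strong_induction_on generalizing s with
  | _ n ih =>
    rcases s.eq_empty_or_nonempty with rfl | ⟨a, ha⟩
    · simp at hn; simp [← hn]
    · have hsub : MulAction.orbit K a ⊆ s := by
        rintro _ ⟨g, rfl⟩
        exact hs g a ha
      have hne : (MulAction.orbit K a).Nonempty := ⟨a, MulAction.mem_orbit_self a⟩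
      have h1 : (s \ MulAction.orbit K a).ncard + (MulAction.orbit K a).ncard = s.ncard :=
        Set.ncard_sdiff_add_ncard_of_subset hsub
      have h2 : 0 < (MulAction.orbit K a).ncard := (Set.ncard_pos (Set.toFinite _)).2 hne
      have h3 : d ∣ (s \ MulAction.orbit K a).ncard := by
        refine ih _ (by omega) (s \ MulAction.orbit K a) ?_ (fun b hb => h b hb.1) rfl
        rintro g b ⟨hb, hb'⟩
        refine ⟨hs g b hb, fun hc => hb' ?_⟩
        obtain ⟨k, hk⟩ := hc
        refine ⟨g⁻¹ * k, ?_⟩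
        simp only at hk ⊢
        rw [mul_smul, hk, inv_smul_smul]
      rw [← hn, ← h1]
      exact Nat.dvd_add h3 (h a ha)

theorem x17_index2 {G : Type*} [Group G] [Finite G] (K L : Subgroup G) (hLK : L ≤ K) (g : G)
    (hgK : g ∈ K) (hgL : g ∉ L) (h : ∀ x ∈ K, x ∈ L ∨ g * x ∈ L) :
    Nat.card K = 2 * Nat.card L := by
  have h1 : L.relIndex K = 2 := by
    rw [Subgroup.relIndex_eq_two_iff_exists_notMem_and']
    exact ⟨g, hgK, hgL, fun b hb => (h b hb).symm⟩
  have h2 := Subgroup.card_mul_index (L.subgroupOf K)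
  rw [← Subgroup.relIndex, h1, Nat.card_congr (Subgroup.subgroupOfEquivOfLe hLK).toEquiv] at h2
  omega

theorem x17_conj_orb {G : Type*} [Group G] [Finite G] (T : Subgroup G) (x : G) :
    {y | ∃ t ∈ T, t * x * t⁻¹ = y}.ncard * Nat.card (T ⊓ Subgroup.centralizer {x} : Subgroup G)
      = Nat.card T := by
  let act : MulAction T G := MulAction.compHom G (MulAut.conj.comp T.subtype)
  have hact : ∀ (t : T) (y : G), t • y = t * y * (t : G)⁻¹ := fun t y => rfl
  have h1 := MulAction.index_stabilizer T x
  have h2 := Subgroup.card_mul_index (MulAction.stabilizer T x)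
  have h3 : MulAction.orbit T x = {y | ∃ t ∈ T, t * x * t⁻¹ = y} := by
    ext y
    simp only [MulAction.mem_orbit_iff, Set.mem_ofPred_eq, hact, Subtype.exists, exists_prop]
  have h4 : Nat.card (MulAction.stabilizer T x)
      = Nat.card (T ⊓ Subgroup.centralizer {x} : Subgroup G) := by
    refine Nat.card_congr ⟨fun t => ⟨t.1.1, t.1.2, ?_⟩, fun t => ⟨⟨t.1, t.2.1⟩, ?_⟩,
      fun _ => rfl, fun _ => rfl⟩
    · have := t.2
      rw [MulAction.mem_stabilizer_iff, hact, mul_inv_eq_iff_eq_mul] at this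
      exact Subgroup.mem_centralizer_singleton_iff.2 this
    · have := Subgroup.mem_centralizer_singleton_iff.1 t.2.2
      rw [MulAction.mem_stabilizer_iff, hact, mul_inv_eq_iff_eq_mul]
      exact this
  rw [h1, h3, h4, mul_comm] at h2
  exact h2

theorem x17_smul_orb {G V : Type*} [Group G] [Finite G] [MulAction G V] (T : Subgroup G) (v : V) :
    {y | ∃ t ∈ T, t • v = y}.ncard * Nat.card (T ⊓ MulAction.stabilizer G v : Subgroup G)
      = Nat.card T := by
  have h1 := MulAction.index_stabilizer T v
  have h2 := Subgroup.card_mul_index (MulAction.stabilizer T v)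
  have h3 : MulAction.orbit T v = {y | ∃ t ∈ T, t • v = y} := by
    ext y
    simp [MulAction.mem_orbit_iff, Subgroup.smul_def]
  have h4 : Nat.card (MulAction.stabilizer T v)
      = Nat.card (T ⊓ MulAction.stabilizer G v : Subgroup G) := by
    refine Nat.card_congr ⟨fun t => ⟨t.1.1, t.1.2, t.2⟩, fun t => ⟨⟨t.1, t.2.1⟩, t.2.2⟩,
      fun _ => rfl, fun _ => rfl⟩
  rw [h1, h3, h4, mul_comm] at h2
  exact h2

/-- a divisor of a `p`-group order that is small. -/
theorem x17_pow_small {p n c : ℕ} (hp : p.Prime) (h : c ∣ p ^ n) (hc : c ≤ 3) (hp3 : 3 ≤ p) :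
    c ∣ 3 := by
  obtain ⟨i, -, rfl⟩ := (Nat.dvd_prime_pow hp).1 h
  rcases i with _ | _ | i
  · simp
  · simp at *
    have : p = 3 := by omega
    simp [this]
  · exfalso
    have : p ^ 2 ≤ p ^ (i + 2) := Nat.pow_le_pow_right (by omega) (by omega)
    nlinarith

theorem x17_pow_small2 {n c : ℕ} (h : c ∣ 2 ^ n) (hc : c ≤ 2) : c ∣ 2 := by
  have : c ≠ 0 := fun h0 => by simp [h0] at h
  interval_cases c <;> simp_all

/-- conjugation of a `p`-group on a set of size not divisible by `p^(j+1)`. -/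
theorem x17_conj_fix {G : Type*} [Group G] [Finite G] (T : Subgroup G) (p j : ℕ) (hp : p.Prime)
    (n : ℕ) (hT : Nat.card T = p ^ n) (s : Set G) (hs : ∀ t ∈ T, ∀ x ∈ s, t * x * t⁻¹ ∈ s)
    (h4 : ¬ p ^ (j + 1) ∣ s.ncard) :
    ∃ x ∈ s, Nat.card T ∣ p ^ j * Nat.card (T ⊓ Subgroup.centralizer {x} : Subgroup G) := by
  by_contra hcon
  push Not at hcon
  apply h4
  let act : MulAction T G := MulAction.compHom G (MulAut.conj.comp T.subtype)
  have hact : ∀ (t : T) (y : G), t • y = t * y * (t : G)⁻¹ := fun t y => rfl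
  refine x17_orb_dvd (K := T) (p ^ (j + 1)) s (fun g a ha => ?_) (fun a ha => ?_)
  · rw [hact]; exact hs g g.2 a ha
  · have h3 : MulAction.orbit T a = {y | ∃ t ∈ T, t * a * t⁻¹ = y} := by
      ext y
      simp only [MulAction.mem_orbit_iff, Set.mem_ofPred_eq, hact, Subtype.exists, exists_prop]
    rw [h3]
    have h5 := x17_conj_orb T a
    have h6 : {y | ∃ t ∈ T, t * a * t⁻¹ = y}.ncard ∣ p ^ n := hT ▸ Dvd.intro _ h5
    obtain ⟨i, -, hi⟩ := (Nat.dvd_prime_pow hp).1 h6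
    rw [hi]
    apply pow_dvd_pow
    by_contra hlt
    apply hcon a ha
    rw [← h5, hi]
    exact Nat.mul_dvd_mul_right (pow_dvd_pow _ (by omega)) _

/-- If every `p`-subgroup of the stabilizer has order dividing `p^j`. -/
theorem x17_orbit_part {G V : Type*} [Group G] [Finite G] [MulAction G V] (v : V) (p i j : ℕ)
    (hp : p.Prime) (hG : p ^ (i + j) ∣ Nat.card G)
    (h : ∀ P : Subgroup G, P ≤ MulAction.stabilizer G v → ∀ n, Nat.card P = p ^ n →
      p ^ n ∣ p ^ j) : p ^ i ∣ (MulAction.orbit G v).ncard := by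
  have := Fact.mk hp
  have h1 := MulAction.index_stabilizer G v
  have h2 := Subgroup.card_mul_index (MulAction.stabilizer G v)
  rw [h1] at h2
  have hne : (MulAction.orbit G v).ncard ≠ 0 := by
    intro h0; rw [h0, mul_zero] at h2
    exact Nat.card_pos.ne h2
  by_contra hcon
  have h5 : p ^ (j + 1) ∣ Nat.card (MulAction.stabilizer G v) := by
    by_contra hc
    rw [Nat.Prime.pow_dvd_iff_le_factorization hp hne] at hcon
    rw [Nat.Prime.pow_dvd_iff_le_factorization hp Nat.card_pos.ne'] at hc
    rw [Nat.Prime.pow_dvd_iff_le_factorization hp Nat.card_pos.ne', ← h2,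
      Nat.factorization_mul Nat.card_pos.ne' hne] at hG
    rw [Finsupp.add_apply] at hG
    omega
  obtain ⟨P, hP⟩ := Sylow.exists_subgroup_card_pow_prime p h5
  have h6 := h (P.map (MulAction.stabilizer G v).subtype) (Subgroup.map_subtype_le P) (j + 1)
    (by rw [Subgroup.card_map_of_injective (Subgroup.subtype_injective _), hP])
  have := (Nat.pow_dvd_pow_iff_le_right hp.one_lt).1 h6
  omega


structure X17Core {G V C : Type*} [Group G] [AddCommGroup V] [DistribMulAction G V]
    [AddCommGroup C] (E : Subgroup G) (z : G) (ω : V → V → C) : Prop where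
  zE : z ∈ E
  z1 : z ≠ 1
  zz : z * z = 1
  zc : ∀ g : G, g * z = z * g
  nor : ∀ g : G, ∀ x ∈ E, g * x * g⁻¹ ∈ E
  sq : ∀ x ∈ E, x * x = 1 ∨ x * x = z
  comm : ∀ x ∈ E, ∀ y ∈ E, x * y = y * x ∨ x * y = z * (y * x)
  cen : ∀ x ∈ E, (∀ y ∈ E, x * y = y * x) → x = 1 ∨ x = z
  card : Nat.card E = 128
  small : ∀ A : Subgroup G, A ≤ E → (∀ x ∈ A, x * x = 1) → Nat.card A ≤ 8
  selfc : ∀ g : G, (∀ x ∈ E, g * x = x * g) → g ∈ E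
  cardG : 2 ^ 13 * 81 * 5 ∣ Nat.card G
  v3 : ∀ v : V, v + v + v = 0
  cardV : Nat.card V = 3 ^ 8
  faith : ∀ (t : G) (k : ℕ), t ^ (2 ^ k) = 1 → (∀ v : V, t • v = v) → t = 1
  wl : ∀ u v w : V, ω (u + v) w = ω u w + ω v w
  wr : ∀ u v w : V, ω u (v + w) = ω u v + ω u w
  w0 : ∀ u : V, ω u u = 0
  winv : ∀ (g : G) (u v : V), ω (g • u) (g • v) = ω u v
  wnd : ∀ u : V, u ≠ 0 → ∃ v, ω u v ≠ 0

/-- stabilizer of a vector in `E`. -/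
abbrev x17S {G V : Type*} [Group G] [MulAction G V] (E : Subgroup G) (w : V) : Subgroup G :=
  E ⊓ MulAction.stabilizer G w

namespace X17Core
set_option linter.unusedSectionVars false
variable {G V C : Type*} [Group G] [Finite G] [AddCommGroup V] [Finite V] [DistribMulAction G V]
    [AddCommGroup C] {E : Subgroup G} {z : G} {ω : V → V → C}

theorem memS {w : V} {x : G} : x ∈ x17S E w ↔ x ∈ E ∧ x • w = w := by
  simp [x17S, Subgroup.mem_inf]

theorem neg_ne (h : X17Core E z ω) {v : V} (hv : v ≠ 0) : v ≠ -v := by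
  intro h1
  apply hv
  have h2 := h.v3 v
  have h3 : v + v = 0 := by nth_rewrite 1 [h1]; simp
  rw [h3, zero_add] at h2
  exact h2

theorem twice (h : X17Core E z ω) (v : V) : v + v = -v :=
  eq_neg_of_add_eq_zero_left (h.v3 v)

theorem anti_of_ne (h : X17Core E z ω) {x y : G} (hx : x ∈ E) (hy : y ∈ E)
    (hne : x * y ≠ y * x) : x * y = z * (y * x) := (h.comm x hx y hy).resolve_left hne

theorem anti_ne (h : X17Core E z ω) {x y : G} (ha : x * y = z * (y * x)) : x * y ≠ y * x := by
  intro h1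
  rw [h1] at ha
  exact h.z1 (by simpa using ha.symm)

theorem ze_ne (h : X17Core E z ω) (x : G) : z * x ≠ x := by
  intro h1
  exact h.z1 (by simpa using h1)

theorem zinv (h : X17Core E z ω) : z⁻¹ = z := inv_eq_of_mul_eq_one_left h.zz

/-- order of 2-elements -/
theorem pow4 (h : X17Core E z ω) {x : G} (hx : x ∈ E) : x ^ 4 = 1 := by
  have e : x ^ 4 = (x * x) * (x * x) := by simp [pow_succ, mul_assoc]
  rw [e]
  rcases h.sq x hx with h1 | h1 <;> rw [h1]
  · simp
  · exact h.zz

theorem odd_pow (h : X17Core E z ω) {x : G} (hx : x ∈ E) {n : ℕ} (hn : Odd n) (hxn : x ^ n = 1) :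
    x = 1 := by
  have h1 : orderOf x ∣ 4 := orderOf_dvd_of_pow_eq_one (h.pow4 hx)
  have h2 : orderOf x ∣ n := orderOf_dvd_of_pow_eq_one hxn
  have h3 : Nat.Coprime 4 n := by
    have : Nat.Coprime 2 n := (Nat.coprime_two_left).2 hn
    exact (Nat.Coprime.pow_left 2 this : Nat.Coprime (2^2) n)
  have h4 : orderOf x ∣ 1 := by
    have := Nat.dvd_gcd h1 h2
    rwa [h3] at this
  rw [← orderOf_eq_one_iff]
  exact Nat.dvd_one.1 h4

/-- coprime action -/
theorem coprime (h : X17Core E z ω) {k c : G} {n : ℕ} (hn : Odd n) (hk : k ^ n = 1)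
    (hd : k * c * k⁻¹ * c⁻¹ ∈ E)
    (hkd : k * (k * c * k⁻¹ * c⁻¹) = (k * c * k⁻¹ * c⁻¹) * k) : k * c = c * k := by
  set d := k * c * k⁻¹ * c⁻¹ with hdd
  have h1 : k * c = d * (c * k) := by rw [hdd]; group
  have h2 : ∀ m : ℕ, k ^ m * c = d ^ m * (c * k ^ m) := by
    intro m
    induction m with
    | zero => simp
    | succ m ih =>
      have hc : Commute k (d ^ m) := Commute.pow_right hkd m
      calc k ^ (m+1) * c = k * (k ^ m * c) := by rw [pow_succ']; group
        _ = (k * d ^ m) * (c * k ^ m) := by rw [ih]; group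
        _ = d ^ m * (k * c) * k ^ m := by rw [hc.eq]; group
        _ = d ^ (m+1) * (c * k ^ (m+1)) := by rw [h1, pow_succ d, pow_succ' k]; group
  have h3 := h2 n
  rw [hk] at h3
  have h4 : d ^ n = 1 := by simpa using h3
  rw [h1, h.odd_pow hd hn h4, one_mul]

theorem faith_odd (h : X17Core E z ω) (X : Set G) (hX : ∀ x ∈ X, x ∈ E)
    (hXX : ∀ x ∈ X, ∀ y ∈ X, x * y = y * x) {k : G} {n : ℕ} (hn : Odd n) (hk : k ^ n = 1)
    (hkC : ∀ c ∈ E, (∀ x ∈ X, c * x = x * c) → k * c = c * k) : k = 1 := by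
  have hX' : ∀ x ∈ X, k * x = x * k := fun x hx => hkC x (hX x hx) (fun y hy => hXX x hx y hy)
  have hall : ∀ g ∈ E, k * g = g * k := by
    intro g hg
    have hdE : k * g * k⁻¹ * g⁻¹ ∈ E := E.mul_mem (h.nor k g hg) (E.inv_mem hg)
    refine h.coprime hn hk hdE ?_
    apply hkC _ hdE
    intro x hx
    have hxE := hX x hx
    have hkx := hX' x hx
    have hkx' : k⁻¹ * x = x * k⁻¹ := by
      rw [inv_mul_eq_iff_eq_mul, ← mul_assoc, hkx, mul_inv_cancel_right]
    rcases h.comm g hg x hxE with hc | hc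
    · have hgi : g⁻¹ * x = x * g⁻¹ := by
        rw [inv_mul_eq_iff_eq_mul, ← mul_assoc, hc, mul_inv_cancel_right]
      calc k * g * k⁻¹ * g⁻¹ * x = k * g * k⁻¹ * (g⁻¹ * x) := by group
        _ = k * g * (k⁻¹ * x) * g⁻¹ := by rw [hgi]; group
        _ = k * (g * x) * k⁻¹ * g⁻¹ := by rw [hkx']; group
        _ = (k * x) * g * k⁻¹ * g⁻¹ := by rw [hc]; group
        _ = x * (k * g * k⁻¹ * g⁻¹) := by rw [hkx]; group
    · have hgi : g⁻¹ * x = z * (x * g⁻¹) := by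
        rw [inv_mul_eq_iff_eq_mul]
        calc x = z * z * x := by rw [h.zz, one_mul]
          _ = z * (z * (x * g)) * g⁻¹ := by group
          _ = z * (g * x) * g⁻¹ := by rw [← hc]
          _ = (g * z) * x * g⁻¹ := by rw [h.zc]; group
          _ = g * (z * (x * g⁻¹)) := by group
      calc k * g * k⁻¹ * g⁻¹ * x = k * g * k⁻¹ * (g⁻¹ * x) := by group
        _ = k * g * (k⁻¹ * z) * x * g⁻¹ := by rw [hgi]; group
        _ = k * (g * z) * (k⁻¹ * x) * g⁻¹ := by rw [h.zc]; group
        _ = (k * z) * (g * x) * k⁻¹ * g⁻¹ := by rw [hkx', h.zc]; group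
        _ = (z * k) * (g * x) * k⁻¹ * g⁻¹ := by rw [h.zc k]
        _ = z * (k * z) * (x * g) * k⁻¹ * g⁻¹ := by rw [hc]; group
        _ = z * z * (k * x) * g * k⁻¹ * g⁻¹ := by rw [h.zc k]; group
        _ = x * (k * g * k⁻¹ * g⁻¹) := by rw [hkx, h.zz]; group
  exact h.odd_pow (h.selfc k hall) hn hk

theorem anti (h : X17Core E z ω) {e x : G} (he : e ∈ E) (hx : x ∈ E) (hee : e * e = 1)
    (h1 : x ≠ 1) (h2 : x ≠ z) (h3 : x ≠ e) (h4 : x ≠ z * e) :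
    ∃ g ∈ E, g * e = e * g ∧ g * x = z * (x * g) := by
  by_contra hcon
  push Not at hcon
  have hall : ∀ g ∈ E, g * e = e * g → g * x = x * g := by
    intro g hg hge
    by_contra hne
    exact hcon g hg hge (h.anti_of_ne hg hx hne)
  obtain ⟨k, hk, hkx⟩ : ∃ k ∈ E, k * x ≠ x * k := by
    by_contra hc
    push Not at hc
    rcases h.cen x hx (fun y hy => (hc y hy).symm) with h5 | h5
    · exact h1 h5
    · exact h2 h5
  have hkx' := h.anti_of_ne hk hx hkx
  have hke : k * e = z * (e * k) := h.anti_of_ne hk he (fun h5 => hkx (hall k hk h5))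
  have hce : ∀ g ∈ E, (x * e) * g = g * (x * e) := by
    intro g hg
    rcases h.comm g hg e he with h5 | h5
    · have h6 := hall g hg h5
      calc x * e * g = x * (e * g) := by group
        _ = (x * g) * e := by rw [← h5]; group
        _ = g * (x * e) := by rw [← h6]; group
    · have h6 : (k * g) * e = e * (k * g) := by
        calc (k * g) * e = k * (g * e) := by group
          _ = (k * z) * e * g := by rw [h5]; group
          _ = z * (k * e) * g := by rw [h.zc]; group
          _ = (z * z) * e * (k * g) := by rw [hke]; group
          _ = e * (k * g) := by rw [h.zz, one_mul]
      have h7 := hall (k * g) (E.mul_mem hk hg) h6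
      have h8 : g * x = z * (x * g) := by
        apply mul_left_cancel (a := k)
        calc k * (g * x) = x * (k * g) := by rw [← h7]; group
          _ = (z * z) * (x * k) * g := by rw [h.zz]; group
          _ = z * (z * (x * k)) * g := by group
          _ = z * (k * x) * g := by rw [hkx']
          _ = (k * z) * (x * g) := by rw [h.zc]; group
          _ = k * (z * (x * g)) := by group
      symm
      calc g * (x * e) = (g * x) * e := by group
        _ = z * x * (g * e) := by rw [h8]; group
        _ = z * (x * z) * e * g := by rw [h5]; group
        _ = (z * z) * x * e * g := by rw [h.zc]; group
        _ = x * e * g := by rw [h.zz, one_mul]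
  rcases h.cen (x * e) (E.mul_mem hx he) hce with h5 | h5
  · apply h3
    calc x = (x * e) * e⁻¹ := by group
      _ = e := by rw [h5, one_mul]; exact inv_eq_of_mul_eq_one_left hee
  · apply h4
    calc x = (x * e) * e⁻¹ := by group
      _ = z * e := by rw [h5]; rw [inv_eq_of_mul_eq_one_left hee]

theorem S_sq (h : X17Core E z ω) {w : V} (hw : w ≠ 0) (hz : z • w = -w) {x : G}
    (hx : x ∈ E) (hxw : x • w = w ∨ x • w = -w) : x * x = 1 := by
  refine (h.sq x hx).resolve_right fun h1 => ?_
  have h2 : (x * x) • w = w := by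
    rw [mul_smul]
    rcases hxw with h3 | h3 <;> rw [h3]
    · exact h3
    · rw [smul_neg, h3, neg_neg]
  rw [h1, hz] at h2
  exact h.neg_ne hw h2.symm

theorem S_comm (h : X17Core E z ω) {w : V} (hw : w ≠ 0) (hz : z • w = -w) {x y : G}
    (hx : x ∈ x17S E w) (hy : y ∈ x17S E w) : x * y = y * x := by
  rw [memS] at hx hy
  by_contra hne
  have h1 := h.anti_of_ne hx.1 hy.1 hne
  have h2 : (x * y) • w = w := by rw [mul_smul, hy.2, hx.2]
  rw [h1, mul_smul, mul_smul, hx.2, hy.2, hz] at h2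
  exact h.neg_ne hw h2.symm

theorem S_card (h : X17Core E z ω) {w : V} (hw : w ≠ 0) (hz : z • w = -w) :
    Nat.card (x17S E w) ≤ 4 := by
  let A : Subgroup G :=
    { carrier := {x | x ∈ E ∧ (x • w = w ∨ x • w = -w)}
      one_mem' := ⟨E.one_mem, Or.inl (one_smul _ _)⟩
      mul_mem' := by
        rintro a b ⟨ha, ha'⟩ ⟨hb, hb'⟩
        refine ⟨E.mul_mem ha hb, ?_⟩
        rw [mul_smul]
        rcases ha' with h1 | h1 <;> rcases hb' with h2 | h2 <;> rw [h2] <;> simp [h1]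
      inv_mem' := by
        rintro a ⟨ha, ha'⟩
        refine ⟨E.inv_mem ha, ?_⟩
        rw [inv_smul_eq_iff, inv_smul_eq_iff, smul_neg]
        rcases ha' with h1 | h1
        · left; exact h1.symm
        · right; rw [h1, neg_neg] }
  have hA : ∀ x, x ∈ A ↔ x ∈ E ∧ (x • w = w ∨ x • w = -w) := fun x => Iff.rfl
  have h1 : Nat.card A = 2 * Nat.card (x17S E w) := by
    refine x17_index2 A (x17S E w) ?_ z ?_ ?_ ?_
    · intro x hx
      rw [memS] at hx
      exact (hA x).2 ⟨hx.1, Or.inl hx.2⟩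
    · exact (hA z).2 ⟨h.zE, Or.inr hz⟩
    · rw [memS]
      rintro ⟨-, h2⟩
      rw [hz] at h2
      exact h.neg_ne hw h2.symm
    · intro x hx
      rw [memS, memS]
      obtain ⟨hx, h2 | h2⟩ := (hA x).1 hx
      · exact Or.inl ⟨hx, h2⟩
      · right
        refine ⟨E.mul_mem h.zE hx, ?_⟩
        rw [mul_smul, h2, smul_neg, hz, neg_neg]
  have h2 := h.small A (fun x hx => ((hA x).1 hx).1)
    (fun x hx => h.S_sq hw hz ((hA x).1 hx).1 ((hA x).1 hx).2)
  omega

theorem E_orb (h : X17Core E z ω) {w : V} (hw : w ≠ 0) (hz : z • w = -w) :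
    32 ∣ (MulAction.orbit E w).ncard := by
  have h1 := x17_smul_orb E w
  have h3 : MulAction.orbit E w = {y | ∃ t ∈ E, t • w = y} := by
    ext y
    simp [MulAction.mem_orbit_iff, Subgroup.smul_def]
  rw [← h3, h.card] at h1
  have h4 := h.S_card hw hz
  have h5 : 0 < Nat.card (x17S E w) := Nat.card_pos
  have h6 : Nat.card (x17S E w) ∣ 128 := Dvd.intro_left _ h1
  change _ * Nat.card (x17S E w) = 128 at h1
  generalize Nat.card (x17S E w) = c at *
  interval_cases c <;> omega

theorem zneg (h : X17Core E z ω) (v : V) : z • v = -v := by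
  let U : AddSubgroup V :=
    { carrier := {v | z • v = -v}
      zero_mem' := by simp
      add_mem' := by
        intro a b ha hb
        simp only [Set.mem_ofPred_eq] at ha hb ⊢
        rw [smul_add, ha, hb, neg_add]
      neg_mem' := by
        intro a ha
        simp only [Set.mem_ofPred_eq] at ha ⊢
        rw [smul_neg, ha] }
  have hU : ∀ v, v ∈ U ↔ z • v = -v := fun v => Iff.rfl
  have hdvd : Nat.card U ∣ 3 ^ 8 := h.cardV ▸ AddSubgroup.card_addSubgroup_dvd_card U
  obtain ⟨k, hk8, hk⟩ := (Nat.dvd_prime_pow Nat.prime_three).1 hdvd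
  have h1 : 32 ∣ ((U : Set V) \ {0}).ncard := by
    refine x17_orb_dvd (K := E) 32 _ ?_ ?_
    · rintro ⟨g, hg⟩ a ⟨ha, ha0⟩
      refine ⟨?_, ?_⟩
      · change z • g • a = -(g • a)
        rw [← mul_smul, ← h.zc, mul_smul, (hU a).1 ha, smul_neg]
      · simp only [Set.mem_singleton_iff, Subgroup.smul_def, smul_eq_zero_iff_eq] at ha0 ⊢
        exact ha0
    · rintro a ⟨ha, ha0⟩
      exact h.E_orb ha0 ((hU a).1 ha)
  have h2 : ((U : Set V) \ {0}).ncard = 3 ^ k - 1 := by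
    rw [Set.ncard_sdiff (by simp)]
    rw [Set.ncard_singleton, ← hk]
    rfl
  rw [h2] at h1
  have h3 : k ≠ 0 := by
    rintro rfl
    rw [pow_zero, AddSubgroup.card_eq_one] at hk
    apply h.z1
    refine h.faith z 1 (by rw [pow_one, pow_two, h.zz]) fun v => ?_
    have h4 : v - z • v ∈ U := by
      rw [hU, smul_sub, ← mul_smul, h.zz, one_smul]
      abel
    rw [hk, AddSubgroup.mem_bot, sub_eq_zero] at h4
    exact h4.symm
  have h5 : k = 8 := by
    interval_cases k <;> simp_all
  have h6 : U = ⊤ := by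
    apply AddSubgroup.eq_top_of_card_eq
    rw [hk, h5, h.cardV]
  have : v ∈ U := by rw [h6]; trivial
  exact this

end X17Core


/-- fixed vectors of an element. -/
def x17F {G V : Type*} [Group G] [AddCommGroup V] [DistribMulAction G V] (e : G) :
    AddSubgroup V where
  carrier := {u | e • u = u}
  zero_mem' := smul_zero e
  add_mem' := by
    intro a b ha hb
    simp only [Set.mem_ofPred_eq] at ha hb ⊢
    rw [smul_add, ha, hb]
  neg_mem' := by
    intro a ha
    simp only [Set.mem_ofPred_eq] at ha ⊢
    rw [smul_neg, ha]

namespace X17Core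
set_option linter.unusedSectionVars false
variable {G V C : Type*} [Group G] [Finite G] [AddCommGroup V] [Finite V] [DistribMulAction G V]
    [AddCommGroup C] {E : Subgroup G} {z : G} {ω : V → V → C}

theorem memF {e : G} {u : V} : u ∈ (x17F e : AddSubgroup V) ↔ e • u = u := Iff.rfl

theorem half (h : X17Core E z ω) (U : AddSubgroup V) (e g : G) (hUe : ∀ u ∈ U, e • u ∈ U)
    (hUg : ∀ u ∈ U, g • u ∈ U) (hUg' : ∀ u ∈ U, g⁻¹ • u ∈ U) (hee : e * e = 1)
    (hge : g * e = z * (e * g)) :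
    Nat.card U = Nat.card (U ⊓ x17F e : AddSubgroup V) ^ 2 := by
  have heg : e * g = z * (g * e) := by rw [hge, ← mul_assoc, h.zz, one_mul]
  have hee' : ∀ u : V, e • e • u = u := fun u => by rw [← mul_smul, hee, one_smul]
  have k1 : ∀ u : V, e • g • u = -(g • e • u) := fun u => by
    rw [← mul_smul, heg, mul_smul, h.zneg, mul_smul]
  have k2 : ∀ b : V, e • b = b → e • g⁻¹ • b = -(g⁻¹ • b) := fun b hb => by
    have : g • (e • g⁻¹ • b) = g • (-(g⁻¹ • b)) := by
      rw [smul_neg, smul_inv_smul, ← mul_smul, hge, mul_smul, h.zneg, mul_smul, smul_inv_smul, hb]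
    exact (smul_left_cancel_iff g).1 this
  have h2 : ∀ v : V, v + v = -v := h.twice
  let φ : U ≃ (U ⊓ x17F e : AddSubgroup V) × (U ⊓ x17F e : AddSubgroup V) :=
    { toFun := fun u => (⟨u.1 + e • u.1, U.add_mem u.2 (hUe _ u.2), by
          change e • _ = _
          rw [smul_add, hee', add_comm]⟩,
        ⟨g • (u.1 - e • u.1), hUg _ (U.sub_mem u.2 (hUe _ u.2)), by
          change e • _ = _
          rw [k1, smul_sub, hee', ← smul_neg, neg_sub]⟩)
      invFun := fun p => ⟨-(p.1.1 + g⁻¹ • p.2.1),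
        U.neg_mem (U.add_mem p.1.2.1 (hUg' _ p.2.2.1))⟩
      left_inv := by
        rintro ⟨u, hu⟩
        apply Subtype.ext
        simp only [inv_smul_smul]
        have := h2 u
        calc -(u + e • u + (u - e • u)) = -(u + u) := by abel
          _ = u := by rw [this, neg_neg]
      right_inv := by
        rintro ⟨⟨a, ha, ha'⟩, ⟨b, hb, hb'⟩⟩
        have ha'' : e • a = a := ha'
        have hb'' := k2 b hb'
        have h3 : e • (-(a + g⁻¹ • b)) = -a + g⁻¹ • b := by
          rw [smul_neg, smul_add, ha'', hb'']; abel
        ext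
        · simp only [h3]
          calc -(a + g⁻¹ • b) + (-a + g⁻¹ • b) = -(a + a) := by abel
            _ = a := by rw [h2, neg_neg]
        · simp only [h3]
          rw [smul_eq_iff_eq_inv_smul]
          calc -(a + g⁻¹ • b) - (-a + g⁻¹ • b) = -(g⁻¹ • b + g⁻¹ • b) := by abel
            _ = g⁻¹ • b := by rw [h2, neg_neg] }
  rw [Nat.card_congr φ, Nat.card_prod, pow_two]

theorem exists_anti (h : X17Core E z ω) {x : G} (hx : x ∈ E) (h1 : x ≠ 1) (h2 : x ≠ z) :
    ∃ g ∈ E, g * x = z * (x * g) := by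
  by_contra hc
  push Not at hc
  rcases h.cen x hx (fun y hy => by
    by_contra hne
    exact hc y hy (h.anti_of_ne hy hx (fun h => hne h.symm))) with h5 | h5
  · exact h1 h5
  · exact h2 h5

theorem card81 (h : X17Core E z ω) {e : G} (he : e ∈ E) (hee : e * e = 1) (h1 : e ≠ 1)
    (h2 : e ≠ z) : Nat.card (x17F e : AddSubgroup V) = 81 := by
  obtain ⟨g, hg, hge⟩ := h.exists_anti he h1 h2
  have h3 := h.half (⊤ : AddSubgroup V) e g (by simp) (by simp) (by simp) hee hge
  rw [top_inf_eq, AddSubgroup.card_top, h.cardV] at h3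
  have : (81 : ℕ) ^ 2 = Nat.card (x17F e : AddSubgroup V) ^ 2 := by rw [← h3]; norm_num
  exact (Nat.pow_left_injective (n := 2) (by norm_num) this).symm

theorem fix_stable {e g : G} (hge : g * e = e * g) {u : V} (hu : e • u = u) :
    e • (g • u) = g • u := by
  rw [← mul_smul, ← hge, mul_smul, hu]

theorem comm_inv {e g : G} (hge : g * e = e * g) : g⁻¹ * e = e * g⁻¹ := by
  rw [inv_mul_eq_iff_eq_mul, ← mul_assoc, hge, mul_inv_cancel_right]

theorem card9 (h : X17Core E z ω) {e x : G} (he : e ∈ E) (hee : e * e = 1) (he1 : e ≠ 1)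
    (he2 : e ≠ z) (hx : x ∈ E) (hxx : x * x = 1) (hxe : x * e = e * x)
    (h1 : x ≠ 1) (h2 : x ≠ z) (h3 : x ≠ e) (h4 : x ≠ z * e) :
    Nat.card (x17F e ⊓ x17F x : AddSubgroup V) = 9 := by
  obtain ⟨g, hg, hge, hgx⟩ := h.anti he hx hee h1 h2 h3 h4
  have h5 := h.half (x17F e) x g (fun u hu => fix_stable hxe hu) (fun u hu => fix_stable hge hu)
    (fun u hu => fix_stable (comm_inv hge) hu) hxx hgx
  rw [h.card81 he hee he1 he2] at h5
  have : (9 : ℕ) ^ 2 = Nat.card (x17F e ⊓ x17F x : AddSubgroup V) ^ 2 := by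
    rw [← h5]; norm_num
  exact (Nat.pow_left_injective (n := 2) (by norm_num) this).symm

theorem half_cent (h : X17Core E z ω) (K : Subgroup G) (hK : K ≤ E) {x g : G} (hx : x ∈ E)
    (hg : g ∈ K) (hgx : g * x = z * (x * g)) :
    Nat.card K = 2 * Nat.card (K ⊓ Subgroup.centralizer {x} : Subgroup G) := by
  refine x17_index2 K _ inf_le_left g hg ?_ ?_
  · rintro ⟨-, h1⟩
    exact h.anti_ne hgx (Subgroup.mem_centralizer_singleton_iff.1 h1)
  · intro y hy
    rcases h.comm y (hK hy) x hx with h1 | h1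
    · exact Or.inl ⟨hy, Subgroup.mem_centralizer_singleton_iff.2 h1⟩
    · refine Or.inr ⟨K.mul_mem hg hy, Subgroup.mem_centralizer_singleton_iff.2 ?_⟩
      calc g * y * x = g * (y * x) := by group
        _ = (g * z) * x * y := by rw [h1]; group
        _ = z * (g * x) * y := by rw [h.zc]; group
        _ = (z * z) * x * (g * y) := by rw [hgx]; group
        _ = x * (g * y) := by rw [h.zz, one_mul]

theorem memCe {e x : G} : x ∈ (E ⊓ Subgroup.centralizer {e} : Subgroup G) ↔
    x ∈ E ∧ x * e = e * x := by
  rw [Subgroup.mem_inf, Subgroup.mem_centralizer_singleton_iff]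

theorem card64 (h : X17Core E z ω) {e : G} (he : e ∈ E) (h1 : e ≠ 1) (h2 : e ≠ z) :
    Nat.card (E ⊓ Subgroup.centralizer {e} : Subgroup G) = 64 := by
  obtain ⟨g, hg, hge⟩ := h.exists_anti he h1 h2
  have := h.half_cent E le_rfl he hg hge
  rw [h.card] at this
  omega

theorem u_ne (h : X17Core E z ω) {e u : G} (hee : e * e = 1) (huu : u * u = z) :
    u ≠ 1 ∧ u ≠ z ∧ u ≠ e ∧ u ≠ z * e := by
  refine ⟨?_, ?_, ?_, ?_⟩ <;> rintro rfl
  · exact h.z1 (by simpa using huu.symm)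
  · exact h.z1 (by rw [← huu, h.zz])
  · exact h.z1 (by rw [← huu, hee])
  · apply h.z1
    calc z = z * e * (z * e) := huu.symm
      _ = z * (e * z) * e := by group
      _ = (z * z) * (e * e) := by rw [h.zc]; group
      _ = 1 := by rw [h.zz, hee, one_mul]

theorem half_invol (h : X17Core E z ω) (K : Subgroup G) (hK : K ≤ E) {u : G}
    (hu : u ∈ K) (hKu : ∀ x ∈ K, x * u = u * x) (huu : u * u = z) :
    Nat.card K = 2 * {x | x ∈ K ∧ x * x = 1}.ncard := by
  have h1 : (K : Set G) = {x | x ∈ K ∧ x * x = 1} ∪ {x | x ∈ K ∧ x * x = z} := by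
    ext x
    simp only [SetLike.mem_coe, Set.mem_union, Set.mem_ofPred_eq]
    constructor
    · intro hx
      rcases h.sq x (hK hx) with h1 | h1
      · exact Or.inl ⟨hx, h1⟩
      · exact Or.inr ⟨hx, h1⟩
    · rintro (h1 | h1) <;> exact h1.1
  have h2 : Disjoint {x | x ∈ K ∧ x * x = 1} {x | x ∈ K ∧ x * x = z} := by
    rw [Set.disjoint_left]
    rintro x ⟨-, h1⟩ ⟨-, h2⟩
    exact h.z1 (by rw [← h2, h1])
  have hmul : ∀ x ∈ K, (x * u) * (x * u) = (x * x) * z := by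
    intro x hx
    calc (x * u) * (x * u) = x * (u * x) * u := by group
      _ = (x * x) * (u * u) := by rw [← hKu x hx]; group
      _ = (x * x) * z := by rw [huu]
  have h3 : {x | x ∈ K ∧ x * x = z} = (fun x => x * u) '' {x | x ∈ K ∧ x * x = 1} := by
    ext x
    simp only [Set.mem_ofPred_eq, Set.mem_image]
    constructor
    · rintro ⟨hx, hxx⟩
      refine ⟨x * u⁻¹, ⟨K.mul_mem hx (K.inv_mem hu), ?_⟩, by group⟩
      have := hmul (x * u⁻¹) (K.mul_mem hx (K.inv_mem hu))
      rw [inv_mul_cancel_right, hxx] at this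
      simpa using this.symm
    · rintro ⟨y, ⟨hy, hyy⟩, rfl⟩
      exact ⟨K.mul_mem hy hu, by rw [hmul y hy, hyy, one_mul]⟩
  have h4 : Nat.card K = (K : Set G).ncard := rfl
  rw [h4, h1, Set.ncard_union_eq h2, h3, Set.ncard_image_of_injective _ (mul_left_injective u)]
  omega

theorem I1card (h : X17Core E z ω) {e u : G} (he : e ∈ E) (hee : e * e = 1) (h1 : e ≠ 1)
    (h2 : e ≠ z) (hu : u ∈ E) (hue : u * e = e * u) (huu : u * u = z) :
    {x | (x ∈ E ∧ x * e = e * x ∧ x * u = u * x) ∧ x * x = 1}.ncard = 16 := by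
  obtain ⟨u1, u2, u3, u4⟩ := h.u_ne hee huu
  obtain ⟨g, hg, hge, hgu⟩ := h.anti he hu hee u1 u2 u3 u4
  set K := (E ⊓ Subgroup.centralizer {e} : Subgroup G) with hK
  have k1 := h.half_cent K inf_le_left hu (memCe.2 ⟨hg, hge⟩) hgu
  rw [h.card64 he h1 h2] at k1
  have hm : ∀ x, x ∈ K ⊓ Subgroup.centralizer {u} ↔ x ∈ E ∧ x * e = e * x ∧ x * u = u * x := by
    intro x
    rw [Subgroup.mem_inf, hK, memCe, Subgroup.mem_centralizer_singleton_iff, and_assoc]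
  have k2 := h.half_invol (K ⊓ Subgroup.centralizer {u}) (fun x hx => ((hm x).1 hx).1)
    ((hm u).2 ⟨hu, hue, rfl⟩) (fun x hx => ((hm x).1 hx).2.2) huu
  have k3 : {x | x ∈ K ⊓ Subgroup.centralizer {u} ∧ x * x = 1}
      = {x | (x ∈ E ∧ x * e = e * x ∧ x * u = u * x) ∧ x * x = 1} := by
    ext x
    simp only [Set.mem_ofPred_eq, hm]
  rw [k3] at k2
  omega

theorem s2card (h : X17Core E z ω) {e : G} (h1 : e ≠ 1) (h2 : e ≠ z) :
    ({1, z, e, z * e} : Set G).ncard = 4 := by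
  rw [Set.ncard_insert_of_notMem, Set.ncard_insert_of_notMem, Set.ncard_pair]
  · exact (h.ze_ne e).symm
  · simp only [Set.mem_insert_iff, Set.mem_singleton_iff, not_or]
    exact ⟨h2.symm, fun h3 => h1 (by simpa using h3.symm)⟩
  · simp only [Set.mem_insert_iff, Set.mem_singleton_iff, not_or]
    refine ⟨h.z1.symm, h1.symm, fun h3 => h2 ?_⟩
    have := eq_inv_of_mul_eq_one_right h3.symm
    rw [this, h.zinv]

theorem exists_ur (h : X17Core E z ω) {e : G} (he : e ∈ E) (hee : e * e = 1) (h1 : e ≠ 1)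
    (h2 : e ≠ z) : ∃ u r : G, u ∈ E ∧ r ∈ E ∧ u * e = e * u ∧ r * e = e * r ∧ u * u = z ∧
      r * r = 1 ∧ r * u = z * (u * r) := by
  obtain ⟨u, ⟨hu, hue⟩, huu⟩ : ∃ u, (u ∈ E ∧ u * e = e * u) ∧ u * u = z := by
    by_contra hc
    push Not at hc
    have k1 := h.small (E ⊓ Subgroup.centralizer {e}) inf_le_left (fun x hx => by
      rw [memCe] at hx
      exact (h.sq x hx.1).resolve_right (hc x hx))
    rw [h.card64 he h1 h2] at k1
    omega
  have k1 := h.I1card he hee h1 h2 hu hue huu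
  obtain ⟨r, hr, hrs⟩ := Set.exists_mem_notMem_of_ncard_lt_ncard (s := {1, z, e, z * e})
    (t := {x | (x ∈ E ∧ x * e = e * x ∧ x * u = u * x) ∧ x * x = 1})
    (by rw [k1, h.s2card h1 h2]; norm_num)
  obtain ⟨⟨hrE, hre, -⟩, hrr⟩ := hr
  simp only [Set.mem_insert_iff, Set.mem_singleton_iff, not_or] at hrs
  obtain ⟨g, hg, hge, hgr⟩ := h.anti he hrE hee hrs.1 hrs.2.1 hrs.2.2.1 hrs.2.2.2
  have hrg : r * g = z * (g * r) := by rw [hgr, ← mul_assoc, h.zz, one_mul]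
  rcases h.sq g hg with h3 | h3
  · refine ⟨g * r, r, E.mul_mem hg hrE, hrE, ?_, hre, ?_, hrr, ?_⟩
    · rw [mul_assoc, hre, ← mul_assoc, hge, mul_assoc]
    · calc g * r * (g * r) = g * (r * g) * r := by group
        _ = (g * z) * g * (r * r) := by rw [hrg]; group
        _ = z * (g * g) * (r * r) := by rw [h.zc]; group
        _ = z := by rw [h3, hrr]; group
    · calc r * (g * r) = (r * g) * r := by group
        _ = z * (g * r * r) := by rw [hrg]; group
  · exact ⟨g, r, hg, hrE, hge, hre, h3, hrr, hrg⟩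

theorem I20 (h : X17Core E z ω) {e : G} (he : e ∈ E) (hee : e * e = 1) (h1 : e ≠ 1)
    (h2 : e ≠ z) :
    20 ≤ {x | x ∈ E ∧ x * e = e * x ∧ x * x = 1 ∧ x ∉ ({1, z, e, z * e} : Set G)}.ncard := by
  obtain ⟨u, r, hu, hr, hue, hre, huu, hrr, hru⟩ := h.exists_ur he hee h1 h2
  set s2 : Set G := {1, z, e, z * e} with hs2
  have hs2p : ∀ b ∈ s2, b ∈ E ∧ b * b = 1 ∧ ∀ x, x * e = e * x → x * b = b * x := by
    intro b hb
    simp only [hs2, Set.mem_insert_iff, Set.mem_singleton_iff] at hb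
    rcases hb with rfl | rfl | rfl | rfl
    · exact ⟨E.one_mem, by simp, by simp⟩
    · exact ⟨h.zE, h.zz, fun x _ => h.zc x⟩
    · exact ⟨he, hee, fun x hx => hx⟩
    · refine ⟨E.mul_mem h.zE he, ?_, fun x hx => ?_⟩
      · calc z * e * (z * e) = z * (e * z) * e := by group
          _ = (z * z) * (e * e) := by rw [h.zc]; group
          _ = 1 := by rw [h.zz, hee, one_mul]
      · rw [← mul_assoc, h.zc, mul_assoc, hx, mul_assoc]
  set s4 : Set G := s2 ∪ (fun b => b * u) '' s2 with hs4
  have hs2c : s2.ncard = 4 := h.s2card h1 h2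
  have hs4c : s4.ncard = 8 := by
    rw [hs4, Set.ncard_union_eq, Set.ncard_image_of_injective _ (mul_left_injective u), hs2c]
    rw [Set.disjoint_left]
    rintro a ha ⟨b, hb, rfl⟩
    obtain ⟨-, ha2, -⟩ := hs2p _ ha
    obtain ⟨-, hb2, hb3⟩ := hs2p _ hb
    simp only at ha2
    apply h.z1
    rw [← ha2, mul_assoc, ← mul_assoc u b, hb3 u hue]
    calc z = u * u := huu.symm
      _ = (b * b) * (u * u) := by rw [hb2, one_mul]
      _ = b * (b * u * u) := by group
  set I1 : Set G := {x | (x ∈ E ∧ x * e = e * x ∧ x * u = u * x) ∧ x * x = 1} with hI1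
  have hI1c : I1.ncard = 16 := h.I1card he hee h1 h2 hu hue huu
  set I2 : Set G := (fun y => r * y) '' s4 with hI2
  have hI2c : I2.ncard = 8 := by
    rw [hI2, Set.ncard_image_of_injective _ (mul_right_injective r), hs4c]
  have hs4p : ∀ y ∈ s4, y ∈ E ∧ y * e = e * y ∧ y * u = u * y ∧ (r * y) * (r * y) = 1 := by
    rintro y (hy | ⟨b, hb, rfl⟩)
    · obtain ⟨a1, a2, a3⟩ := hs2p y hy
      refine ⟨a1, (a3 e rfl).symm, (a3 u hue).symm, ?_⟩
      calc (r * y) * (r * y) = (r * y) * (y * r) := by rw [a3 r hre]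
        _ = r * (y * y) * r := by group
        _ = 1 := by rw [a2, mul_one, hrr]
    · obtain ⟨a1, a2, a3⟩ := hs2p b hb
      refine ⟨E.mul_mem a1 hu, ?_, ?_, ?_⟩
      · simp only
        rw [mul_assoc, hue, ← mul_assoc, ← a3 e rfl, mul_assoc]
      · simp only
        rw [← mul_assoc, a3 u hue]
      · simp only
        calc (r * (b * u)) * (r * (b * u)) = r * b * u * (r * b) * u := by group
          _ = r * b * (u * b) * r * u := by rw [a3 r hre]; group
          _ = r * (b * b) * u * (r * u) := by rw [a3 u hue]; group
          _ = r * (u * z) * u * r := by rw [a2, hru]; group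
          _ = (r * z) * (u * u) * r := by rw [h.zc]; group
          _ = z * (r * z) * r := by rw [huu, h.zc]
          _ = z * z * (r * r) := by rw [h.zc r]; group
          _ = 1 := by rw [h.zz, hrr, one_mul]
  have hdis : Disjoint I1 I2 := by
    rw [Set.disjoint_left]
    rintro x ⟨⟨-, -, hxu⟩, -⟩ ⟨y, hy, rfl⟩
    obtain ⟨-, -, hyu, -⟩ := hs4p y hy
    simp only at hxu
    have : u * r = r * u := by
      apply mul_right_cancel (b := y)
      rw [mul_assoc, ← hxu, mul_assoc, hyu, mul_assoc]
    exact h.anti_ne hru this.symm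
  have hsub : I1 ∪ I2 ⊆ {x | x ∈ E ∧ x * e = e * x ∧ x * x = 1 ∧ x ∉ s2} ∪ s2 := by
    intro x hx
    by_cases hxs : x ∈ s2
    · exact Or.inr hxs
    · left
      rcases hx with ⟨⟨a1, a2, a3⟩, a4⟩ | ⟨y, hy, rfl⟩
      · exact ⟨a1, a2, a4, hxs⟩
      · obtain ⟨a1, a2, a3, a4⟩ := hs4p y hy
        exact ⟨E.mul_mem hr a1, by simp only; rw [mul_assoc, a2, ← mul_assoc, hre, mul_assoc], a4,
          hxs⟩
  have k1 := Set.ncard_le_ncard hsub (Set.toFinite _)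
  have k2 := Set.ncard_union_le {x | x ∈ E ∧ x * e = e * x ∧ x * x = 1 ∧ x ∉ s2} s2
  rw [Set.ncard_union_eq hdis, hI1c, hI2c] at k1
  omega

end X17Core


theorem x17_dc {α β : Type*} [Finite α] [Finite β] (A : Set α) (B : Set β) (r : α → β → Prop)
    (m n : ℕ) (ha : ∀ a ∈ A, m ≤ {b | b ∈ B ∧ r a b}.ncard)
    (hb : ∀ b ∈ B, {a | a ∈ A ∧ r a b}.ncard ≤ n) : A.ncard * m ≤ B.ncard * n := by
  classical
  have := Fintype.ofFinite α
  have := Fintype.ofFinite β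
  have h1 := Finset.card_mul_le_card_mul (s := A.toFinset) (t := B.toFinset) (m := m) (n := n) r
    (fun a h => by
      have := ha a (by simpa using h)
      refine this.trans (le_of_eq ?_)
      rw [← Set.ncard_coe_finset]
      congr 1
      ext b
      simp [Finset.bipartiteAbove])
    (fun b h => by
      have := hb b (by simpa using h)
      refine le_trans (le_of_eq ?_) this
      rw [← Set.ncard_coe_finset]
      congr 1
      ext b
      simp [Finset.bipartiteBelow])
  rwa [← Set.ncard_eq_toFinset_card', ← Set.ncard_eq_toFinset_card'] at h1

namespace X17Core
set_option linter.unusedSectionVars false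
variable {G V C : Type*} [Group G] [Finite G] [AddCommGroup V] [Finite V] [DistribMulAction G V]
    [AddCommGroup C] {E : Subgroup G} {z : G} {ω : V → V → C}

theorem S_ne_z (h : X17Core E z ω) {w : V} (hw : w ≠ 0) {e : G} (hew : e • w = w) : e ≠ z := by
  rintro rfl
  exact h.neg_ne hw (by rw [← h.zneg w, hew])

theorem S_invol (h : X17Core E z ω) {w : V} (hw : w ≠ 0) {e : G} (he : e ∈ x17S E w) :
    e * e = 1 := h.S_sq hw (h.zneg w) (memS.1 he).1 (Or.inl (memS.1 he).2)

theorem four (h : X17Core E z ω) {w : V} (hw : w ≠ 0) {e f : G} (he : e ∈ x17S E w)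
    (hf : f ∈ x17S E w) (he1 : e ≠ 1) (hf1 : f ≠ 1) (hfe : f ≠ e) :
    ((x17S E w : Subgroup G) : Set G) = {1, e, f, e * f} := by
  have hee := h.S_invol hw he
  have h1 : ({1, e, f, e * f} : Set G).ncard = 4 := by
    rw [Set.ncard_insert_of_notMem, Set.ncard_insert_of_notMem, Set.ncard_pair]
    · intro h3
      exact he1 (by simpa using h3.symm)
    · simp only [Set.mem_insert_iff, Set.mem_singleton_iff, not_or]
      exact ⟨hfe.symm, fun h3 => hf1 (by simpa using h3.symm)⟩
    · simp only [Set.mem_insert_iff, Set.mem_singleton_iff, not_or]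
      refine ⟨he1.symm, hf1.symm, fun h3 => hfe ?_⟩
      have h4 := eq_inv_of_mul_eq_one_right h3.symm
      rw [h4, inv_eq_of_mul_eq_one_left hee]
  symm
  apply Set.eq_of_subset_of_ncard_le
  · rintro x (rfl | rfl | rfl | rfl)
    · exact (x17S E w).one_mem
    · exact he
    · exact hf
    · exact (x17S E w).mul_mem he hf
  · rw [h1]
    exact h.S_card hw (h.zneg w)
  · exact Set.toFinite _

theorem S4 (h : X17Core E z ω) {w : V} (hw : w ≠ 0) {e : G} (he : e ∈ x17S E w)
    (he1 : e ≠ 1) : ∃ f ∈ x17S E w, f ≠ 1 ∧ f ≠ e := by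
  by_contra hc
  push Not at hc
  have hee := h.S_invol hw he
  obtain ⟨heE, hew⟩ := memS.1 he
  have hez := h.S_ne_z hw hew
  have h20 := h.I20 heE hee he1 hez
  set I' := {x | x ∈ E ∧ x * e = e * x ∧ x * x = 1 ∧ x ∉ ({1, z, e, z * e} : Set G)} with hI'
  set B : Set V := {v | e • v = v ∧ v ≠ 0 ∧ v ≠ w} with hB
  have hBc : B.ncard + 2 = 81 := by
    have h81 := h.card81 heE hee he1 hez
    have k1 : B = ((x17F e : AddSubgroup V) : Set V) \ {0, w} := by
      ext v
      simp only [hB, Set.mem_ofPred_eq, Set.mem_diff, SetLike.mem_coe, memF, Set.mem_insert_iff,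
        Set.mem_singleton_iff, not_or]
    have k2 : ({0, w} : Set V).ncard = 2 := Set.ncard_pair hw.symm
    have k3 := Set.ncard_sdiff_add_ncard_of_subset (s := {0, w})
      (t := ((x17F e : AddSubgroup V) : Set V)) (by
        rintro v (rfl | rfl)
        · exact AddSubgroup.zero_mem _
        · exact hew)
    rw [← k1, k2] at k3
    rw [k3]
    exact h81
  have hdc := x17_dc I' B (fun x v => x • v = v) 8 2 (by
    rintro x ⟨hx, hxe, hxx, hxs⟩
    simp only [Set.mem_insert_iff, Set.mem_singleton_iff, not_or] at hxs
    have h9 := h.card9 heE hee he1 hez hx hxx hxe hxs.1 hxs.2.1 hxs.2.2.1 hxs.2.2.2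
    have hxw : x • w ≠ w := fun h5 => hxs.2.2.1 (hc x (memS.2 ⟨hx, h5⟩) hxs.1)
    have k1 : ((x17F e ⊓ x17F x : AddSubgroup V) : Set V) \ {0} ⊆ {b | b ∈ B ∧ x • b = b} := by
      rintro v ⟨⟨hv1, hv2⟩, hv0⟩
      refine ⟨⟨hv1, hv0, ?_⟩, hv2⟩
      rintro rfl
      exact hxw hv2
    have k2 := Set.ncard_le_ncard k1 (Set.toFinite _)
    have k3 := Set.ncard_sdiff_add_ncard_of_subset (s := {0})
      (t := ((x17F e ⊓ x17F x : AddSubgroup V) : Set V)) (by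
        rintro v rfl
        exact AddSubgroup.zero_mem _)
    rw [Set.ncard_singleton] at k3
    have k4 : ((x17F e ⊓ x17F x : AddSubgroup V) : Set V).ncard = 9 := h9
    omega) (by
    rintro v ⟨hv, hv0, -⟩
    have k1 : {a | a ∈ I' ∧ a • v = v} ⊆ ((x17S E v : Subgroup G) : Set G) \ {1, e} := by
      rintro x ⟨⟨hx, hxe, hxx, hxs⟩, hxv⟩
      simp only [Set.mem_insert_iff, Set.mem_singleton_iff, not_or] at hxs
      refine ⟨memS.2 ⟨hx, hxv⟩, ?_⟩
      simp only [Set.mem_insert_iff, Set.mem_singleton_iff, not_or]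
      exact ⟨hxs.1, hxs.2.2.1⟩
    have k2 := Set.ncard_le_ncard k1 (Set.toFinite _)
    have k3 := Set.ncard_sdiff_add_ncard_of_subset (s := {1, e})
      (t := ((x17S E v : Subgroup G) : Set G)) (by
        rintro x (rfl | rfl)
        · exact Subgroup.one_mem _
        · exact memS.2 ⟨heE, hv⟩)
    rw [Set.ncard_pair he1.symm] at k3
    have k4 : ((x17S E v : Subgroup G) : Set G).ncard ≤ 4 := h.S_card hv0 (h.zneg v)
    omega)
  omega

theorem wz (h : X17Core E z ω) (u : V) : ω u 0 = 0 := by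
  have := h.wr u 0 0
  simpa using this

theorem w3 (h : X17Core E z ω) (u v : V) : ω u v + ω u v + ω u v = 0 := by
  rw [← h.wr, ← h.wr, h.v3, h.wz]

theorem wsub (h : X17Core E z ω) (u v w : V) : ω u (v - w) = ω u v - ω u w := by
  have := h.wr u (v - w) w
  rw [sub_add_cancel] at this
  rw [this, add_sub_cancel_right]

theorem S_card9 (h : X17Core E z ω) {w : V} (hw : w ≠ 0) {e f : G} (he : e ∈ x17S E w)
    (hf : f ∈ x17S E w) (he1 : e ≠ 1) (hf1 : f ≠ 1) (hfe : f ≠ e) :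
    Nat.card (x17F e ⊓ x17F f : AddSubgroup V) = 9 := by
  have hew := (memS.1 he).2
  have hfw := (memS.1 hf).2
  refine h.card9 (memS.1 he).1 (h.S_invol hw he) he1 (h.S_ne_z hw hew) (memS.1 hf).1
    (h.S_invol hw hf) (h.S_comm hw (h.zneg w) hf he) hf1 (h.S_ne_z hw hfw) hfe ?_
  rintro rfl
  rw [mul_smul, hew, h.zneg] at hfw
  exact h.neg_ne hw hfw.symm

theorem omega_ex (h : X17Core E z ω) {w : V} (hw : w ≠ 0) {e f : G} (he : e ∈ x17S E w)
    (hf : f ∈ x17S E w) : ∃ x, e • x = x ∧ f • x = x ∧ ω w x ≠ 0 := by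
  obtain ⟨y, hy⟩ := h.wnd w hw
  have hee := h.S_invol hw he
  have hff := h.S_invol hw hf
  have hef := h.S_comm hw (h.zneg w) he hf
  have hew := (memS.1 he).2
  have hfw := (memS.1 hf).2
  have a1 : ∀ v, ω w (e • v) = ω w v := fun v => by
    conv_lhs => rw [← hew]
    rw [h.winv]
  have a2 : ∀ v, ω w (f • v) = ω w v := fun v => by
    conv_lhs => rw [← hfw]
    rw [h.winv]
  have b1 : ∀ v : V, e • e • v = v := fun v => by rw [← mul_smul, hee, one_smul]
  have b2 : ∀ v : V, f • f • v = v := fun v => by rw [← mul_smul, hff, one_smul]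
  have b3 : ∀ v : V, f • e • v = e • f • v := fun v => by rw [← mul_smul, ← hef, mul_smul]
  refine ⟨y + e • y + (f • y + e • f • y), ?_, ?_, ?_⟩
  · simp only [smul_add, b1]
    abel
  · simp only [smul_add, b2, b3]
    abel
  · simp only [h.wr, a1, a2]
    intro h1
    apply hy
    have := h.w3 w y
    calc ω w y = ω w y + ω w y + (ω w y + ω w y) - (ω w y + ω w y + ω w y) := by abel
      _ = 0 := by rw [h1, this, sub_zero]

theorem omega_ker (h : X17Core E z ω) {w : V} (hw : w ≠ 0) {e f : G} (he : e ∈ x17S E w)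
    (hf : f ∈ x17S E w) (he1 : e ≠ 1) (hf1 : f ≠ 1) (hfe : f ≠ e) {x : V} (hex : e • x = x)
    (hfx : f • x = x) (hx : ω w x = 0) : x = 0 ∨ x = w ∨ x = -w := by
  obtain ⟨x0, h1, h2, h3⟩ := h.omega_ex hw he hf
  have h9 := h.S_card9 hw he hf he1 hf1 hfe
  set X := (x17F e ⊓ x17F f : AddSubgroup V) with hX
  have hneg : ∀ v, ω w v = 0 → ω w (-v) = 0 := fun v hv => by
    rw [← zero_sub, h.wsub, h.wz, hv, sub_zero]
  let K : AddSubgroup V :=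
    { carrier := {v | v ∈ X ∧ ω w v = 0}
      zero_mem' := ⟨X.zero_mem, h.wz w⟩
      add_mem' := by
        rintro a b ⟨ha, ha'⟩ ⟨hb, hb'⟩
        exact ⟨X.add_mem ha hb, by rw [h.wr, ha', hb', add_zero]⟩
      neg_mem' := by
        rintro a ⟨ha, ha'⟩
        exact ⟨X.neg_mem ha, hneg a ha'⟩ }
  have hKX : K ≤ X := fun v hv => hv.1
  have c1 : Nat.card K ∣ 9 := by
    rw [← h9]
    exact AddSubgroup.card_dvd_of_le hKX
  have c2 : Nat.card K < 9 := by
    rw [← h9]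
    exact Set.ncard_lt_ncard (s := (K : Set V)) (t := (X : Set V))
      ⟨hKX, fun h4 => h3 (h4 (⟨h1, h2⟩ : x0 ∈ X)).2⟩ (Set.toFinite _)
  have c3 : Nat.card K ≤ 3 := by
    have : ∀ n < 9, n ∣ 9 → n ≤ 3 := by decide
    exact this _ c2 c1
  have c4 : ({0, w, -w} : Set V).ncard = 3 := by
    rw [Set.ncard_insert_of_notMem, Set.ncard_pair (h.neg_ne hw)]
    simp only [Set.mem_insert_iff, Set.mem_singleton_iff, not_or]
    exact ⟨hw.symm, fun h4 => hw (by simpa using h4.symm)⟩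
  have hwK : w ∈ K := ⟨⟨(memS.1 he).2, (memS.1 hf).2⟩, h.w0 w⟩
  have c5 : ({0, w, -w} : Set V) = (K : Set V) := by
    apply Set.eq_of_subset_of_ncard_le
    · rintro v (rfl | rfl | rfl)
      · exact K.zero_mem
      · exact hwK
      · exact K.neg_mem hwK
    · rw [c4]; exact c3
    · exact Set.toFinite _
  have c6 : x ∈ (K : Set V) := ⟨⟨hex, hfx⟩, hx⟩
  rw [← c5] at c6
  simpa using c6

theorem omega_act (h : X17Core E z ω) {w : V} (hw : w ≠ 0) {e f : G} (he : e ∈ x17S E w)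
    (hf : f ∈ x17S E w) (he1 : e ≠ 1) (hf1 : f ≠ 1) (hfe : f ≠ e) {g : G} (hgw : g • w = w)
    (hge : g * e = e * g) (hgf : g * f = f * g) {x : V} (hex : e • x = x)
    (hfx : f • x = x) : g • x - x = 0 ∨ g • x - x = w ∨ g • x - x = -w := by
  apply h.omega_ker hw he hf he1 hf1 hfe
  · rw [smul_sub, fix_stable hge hex, hex]
  · rw [smul_sub, fix_stable hgf hfx, hfx]
  · rw [h.wsub, sub_eq_zero]
    conv_lhs => rw [← hgw]
    rw [h.winv]

theorem triv_pow (h : X17Core E z ω) {c x : V} {g : G} (hc : g • c = c) (hx : g • x - x = c)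
    {n : ℕ} (hn : Nat.Coprime n 3) (hg : g ^ n = 1) : c = 0 := by
  have h1 : ∀ m : ℕ, g ^ m • x = x + m • c := by
    intro m
    induction m with
    | zero => simp
    | succ m ih =>
      have h2 : g • (m • c) = m • c := by rw [smul_comm g m c, hc]
      rw [pow_succ', mul_smul, ih, smul_add, h2, ← sub_add_cancel (g • x) x, hx, add_smul, one_smul]
      abel
  have h2 := h1 n
  rw [hg, one_smul] at h2
  have h3 : n • c = 0 := by simpa using h2.symm
  have h4 : 3 • c = 0 := by
    have := h.v3 c
    rw [← this]
    simp [succ_nsmul]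
  have h5 : addOrderOf c ∣ 1 := by
    have := Nat.dvd_gcd (addOrderOf_dvd_of_nsmul_eq_zero h3) (addOrderOf_dvd_of_nsmul_eq_zero h4)
    rwa [hn] at this
  rw [← AddMonoid.addOrderOf_eq_one_iff]
  exact Nat.dvd_one.1 h5

/-- an element of order prime to 3 fixing `w` and centralizing its stabilizer is trivial on the
fixed space. -/
theorem omega_triv (h : X17Core E z ω) {w : V} (hw : w ≠ 0) {e f : G} (he : e ∈ x17S E w)
    (hf : f ∈ x17S E w) (he1 : e ≠ 1) (hf1 : f ≠ 1) (hfe : f ≠ e) {g : G} (hgw : g • w = w)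
    (hge : g * e = e * g) (hgf : g * f = f * g) {n : ℕ} (hn : Nat.Coprime n 3) (hg : g ^ n = 1)
    {x : V} (hex : e • x = x) (hfx : f • x = x) : g • x = x := by
  rw [← sub_eq_zero]
  refine h.triv_pow (c := g • x - x) ?_ rfl hn hg
  rcases h.omega_act hw he hf he1 hf1 hfe hgw hge hgf hex hfx with h1 | h1 | h1 <;> rw [h1]
  · simp
  · exact hgw
  · rw [smul_neg, hgw]

end X17Core


namespace X17Core
set_option linter.unusedSectionVars false
variable {G V C : Type*} [Group G] [Finite G] [AddCommGroup V] [Finite V] [DistribMulAction G V]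
    [AddCommGroup C] {E : Subgroup G} {z : G} {ω : V → V → C}

theorem S_conj (h : X17Core E z ω) {w : V} {g x : G} (hg : g • w = w) (hx : x ∈ x17S E w) :
    g * x * g⁻¹ ∈ x17S E w := by
  obtain ⟨h1, h2⟩ := memS.1 hx
  refine memS.2 ⟨h.nor g x h1, ?_⟩
  have hg' : g⁻¹ • w = w := by rw [inv_smul_eq_iff, hg]
  rw [mul_smul, mul_smul, hg', h2, hg]

theorem S_mem (h : X17Core E z ω) {w : V} (hw : w ≠ 0) {e f : G} (he : e ∈ x17S E w)
    (hf : f ∈ x17S E w) (he1 : e ≠ 1) (hf1 : f ≠ 1) (hfe : f ≠ e) {x : G} (hx : x ∈ x17S E w) :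
    x = 1 ∨ x = e ∨ x = f ∨ x = e * f := by
  have h1 : x ∈ ((x17S E w : Subgroup G) : Set G) := hx
  rw [h.four hw he hf he1 hf1 hfe] at h1
  simpa using h1

theorem conj_f (h : X17Core E z ω) {w : V} (hw : w ≠ 0) {e f : G} (he : e ∈ x17S E w)
    (hf : f ∈ x17S E w) (he1 : e ≠ 1) (hf1 : f ≠ 1) (hfe : f ≠ e) {g : G} (hg : g • w = w)
    (hge : g * e = e * g) : g * f * g⁻¹ = f ∨ g * f * g⁻¹ = e * f := by
  rcases h.S_mem hw he hf he1 hf1 hfe (h.S_conj hg hf) with h1 | h1 | h1 | h1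
  · exact absurd (by simpa using h1) hf1
  · exfalso
    apply hfe
    rw [mul_inv_eq_iff_eq_mul, ← hge] at h1
    exact mul_left_cancel h1
  · exact Or.inl h1
  · exact Or.inr h1

/-- elements of odd order acting trivially on the fixed space are trivial. -/
theorem triv_of_fix (h : X17Core E z ω) {w : V} (hw : w ≠ 0) {e f : G} (he : e ∈ x17S E w)
    (hf : f ∈ x17S E w) (he1 : e ≠ 1) (hf1 : f ≠ 1) (hfe : f ≠ e) {k : G} (hkw : k • w = w)
    (hke : k * e = e * k) (hkf : k * f = f * k) {n : ℕ} (hn : Odd n) (hk : k ^ n = 1) {x0 : V}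
    (hex : e • x0 = x0) (hfx : f • x0 = x0) (hx0 : ω w x0 ≠ 0) (hkx : k • x0 = x0) : k = 1 := by
  have hXfix : ∀ x : V, e • x = x → f • x = x → k • x = x := by
    have h9 := h.S_card9 hw he hf he1 hf1 hfe
    set X := (x17F e ⊓ x17F f : AddSubgroup V) with hX
    let K : AddSubgroup V := X ⊓ x17F k
    have hwK : w ∈ K := ⟨⟨(memS.1 he).2, (memS.1 hf).2⟩, hkw⟩
    have hxK : x0 ∈ K := ⟨⟨hex, hfx⟩, hkx⟩
    have hw1 := h.w0 w
    have hneg : ω w (-w) = 0 := by rw [← zero_sub, h.wsub, h.wz, hw1, sub_zero]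
    have c1 : Nat.card K ∣ 9 := by
      rw [← h9]
      exact AddSubgroup.card_dvd_of_le inf_le_left
    have c4 : ({x0, 0, w, -w} : Set V).ncard = 4 := by
      rw [Set.ncard_insert_of_notMem, Set.ncard_insert_of_notMem, Set.ncard_pair (h.neg_ne hw)]
      · simp only [Set.mem_insert_iff, Set.mem_singleton_iff, not_or]
        exact ⟨hw.symm, fun h4 => hw (by simpa using h4.symm)⟩
      · rintro (rfl | rfl | rfl)
        · exact hx0 (h.wz w)
        · exact hx0 hw1
        · exact hx0 hneg
    have c5 : ({x0, 0, w, -w} : Set V) ⊆ (K : Set V) := by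
      rintro v (rfl | rfl | rfl | rfl)
      · exact hxK
      · exact K.zero_mem
      · exact hwK
      · exact K.neg_mem hwK
    have c6 : 4 ≤ Nat.card K := by
      rw [← c4]
      exact Set.ncard_le_ncard c5 (Set.toFinite _)
    have c7 : Nat.card K = 9 := by
      have : ∀ m < 10, m ∣ 9 → 4 ≤ m → m = 9 := by decide
      exact this _ (Nat.lt_succ_of_le (Nat.le_of_dvd (by norm_num) c1)) c1 c6
    have c8 : (K : Set V) = (X : Set V) := by
      apply Set.eq_of_subset_of_ncard_le
      · exact fun v hv => hv.1
      · change Nat.card X ≤ Nat.card K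
        rw [h9, c7]
      · exact Set.toFinite _
    intro x h1 h2
    have : x ∈ (X : Set V) := ⟨h1, h2⟩
    rw [← c8] at this
    exact this.2
  refine h.faith_odd {e, f} ?_ ?_ hn hk ?_
  · rintro x (rfl | rfl)
    · exact (memS.1 he).1
    · exact (memS.1 hf).1
  · have := h.S_comm hw (h.zneg w) he hf
    rintro x (rfl | rfl) y (rfl | rfl)
    · rfl
    · exact this
    · exact this.symm
    · rfl
  · intro c hc hcX
    have ce : c * e = e * c := hcX e (by simp)
    have cf : c * f = f * c := hcX f (by simp)
    have hdE : k * c * k⁻¹ * c⁻¹ ∈ E := E.mul_mem (h.nor k c hc) (E.inv_mem hc)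
    have hfix : k • (c⁻¹ • w) = c⁻¹ • w := hXfix _
      (fix_stable (comm_inv ce) (memS.1 he).2) (fix_stable (comm_inv cf) (memS.1 hf).2)
    have hfix' : k⁻¹ • (c⁻¹ • w) = c⁻¹ • w := by rw [inv_smul_eq_iff, hfix]
    have hd : k * c * k⁻¹ * c⁻¹ ∈ x17S E w := by
      refine memS.2 ⟨hdE, ?_⟩
      rw [mul_smul, mul_smul, mul_smul, hfix', smul_inv_smul, hkw]
    apply h.coprime hn hk hdE
    generalize k * c * k⁻¹ * c⁻¹ = d at hd
    rcases h.S_mem hw he hf he1 hf1 hfe hd with rfl | rfl | rfl | rfl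
    · simp
    · exact hke
    · exact hkf
    · rw [← mul_assoc, hke, mul_assoc, hkf, mul_assoc]

theorem class1_p (h : X17Core E z ω) {w : V} (hw : w ≠ 0) {e : G} (he : e ∈ x17S E w)
    (he1 : e ≠ 1) {p : ℕ} (hp : p.Prime) (hp3 : 3 ≤ p) (P : Subgroup G)
    (hP : P ≤ MulAction.stabilizer G w) {n : ℕ} (hn : Nat.card P = p ^ n) : Nat.card P ∣ 9 := by
  obtain ⟨f, hf, hf1, hfe⟩ := h.S4 hw he he1
  have hPw : ∀ t ∈ P, t • w = w := fun t ht => hP ht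
  -- first step
  have k1 := x17_conj_orb P e
  have s1 : {y | ∃ t ∈ P, t * e * t⁻¹ = y} ⊆ ({e, f, e * f} : Set G) := by
    rintro _ ⟨t, ht, rfl⟩
    rcases h.S_mem hw he hf he1 hf1 hfe (h.S_conj (hPw t ht) he) with h1 | h1 | h1 | h1
    · exact absurd (by simpa using h1) he1
    · simp [h1]
    · simp [h1]
    · simp [h1]
  have c1 : {y | ∃ t ∈ P, t * e * t⁻¹ = y}.ncard ∣ 3 := by
    refine x17_pow_small hp (n := n) ?_ ?_ hp3
    · rw [← hn, ← k1]; exact dvd_mul_right _ _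
    · refine (Set.ncard_le_ncard s1 (Set.toFinite _)).trans ?_
      refine (Set.ncard_insert_le _ _).trans ?_
      have := Set.ncard_insert_le f {e * f}
      rw [Set.ncard_singleton] at this
      omega
  set P1 := (P ⊓ Subgroup.centralizer {e} : Subgroup G) with hP1
  have hP1' : ∀ t ∈ P1, t ∈ P ∧ t * e = e * t := fun t ht =>
    ⟨ht.1, Subgroup.mem_centralizer_singleton_iff.1 ht.2⟩
  have d1 : Nat.card P1 ∣ p ^ n := by rw [← hn, ← k1]; exact dvd_mul_left _ _
  -- second step
  have k2 := x17_conj_orb P1 f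
  have s2 : {y | ∃ t ∈ P1, t * f * t⁻¹ = y} ⊆ ({f, e * f} : Set G) := by
    rintro _ ⟨t, ht, rfl⟩
    rcases h.conj_f hw he hf he1 hf1 hfe (hPw t (hP1' t ht).1) (hP1' t ht).2 with h1 | h1
    · simp [h1]
    · simp [h1]
  have c2' : {y | ∃ t ∈ P1, t * f * t⁻¹ = y}.ncard ≤ 2 := by
    refine (Set.ncard_le_ncard s2 (Set.toFinite _)).trans ?_
    have := Set.ncard_insert_le f {e * f}
    rw [Set.ncard_singleton] at this
    omega
  have c2 : {y | ∃ t ∈ P1, t * f * t⁻¹ = y}.ncard = 1 := by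
    have : {y | ∃ t ∈ P1, t * f * t⁻¹ = y}.ncard ∣ 3 := by
      refine x17_pow_small hp (n := n) ?_ (by omega) hp3
      refine dvd_trans ?_ d1
      rw [← k2]; exact dvd_mul_right _ _
    have h3 : ∀ m ≤ 2, m ∣ 3 → m = 1 := by decide
    exact h3 _ c2' this
  rw [c2, one_mul] at k2
  set P2 := (P1 ⊓ Subgroup.centralizer {f} : Subgroup G) with hP2
  have hP2' : ∀ t ∈ P2, t ∈ P ∧ t * e = e * t ∧ t * f = f * t := fun t ht =>
    ⟨(hP1' t ht.1).1, (hP1' t ht.1).2, Subgroup.mem_centralizer_singleton_iff.1 ht.2⟩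
  -- third step
  obtain ⟨x0, hex, hfx, hx0⟩ := h.omega_ex hw he hf
  have k3 := x17_smul_orb P2 x0
  have s3 : {y | ∃ t ∈ P2, t • x0 = y} ⊆ ({x0, w + x0, -w + x0} : Set V) := by
    rintro _ ⟨t, ht, rfl⟩
    obtain ⟨t1, t2, t3⟩ := hP2' t ht
    rcases h.omega_act hw he hf he1 hf1 hfe (hPw t t1) t2 t3 hex hfx with h1 | h1 | h1
    · simp [sub_eq_zero.1 h1]
    · simp [sub_eq_iff_eq_add.1 h1]
    · simp [sub_eq_iff_eq_add.1 h1]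
  have c3 : {y | ∃ t ∈ P2, t • x0 = y}.ncard ∣ 3 := by
    refine x17_pow_small hp (n := n) ?_ ?_ hp3
    · refine dvd_trans ?_ d1
      rw [← k2, ← k3]; exact dvd_mul_right _ _
    · refine (Set.ncard_le_ncard s3 (Set.toFinite _)).trans ?_
      refine (Set.ncard_insert_le _ _).trans ?_
      have := Set.ncard_insert_le (w + x0) {-w + x0}
      rw [Set.ncard_singleton] at this
      omega
  have hodd : Odd (p ^ n) := (hp.odd_of_ne_two (by omega)).pow
  have hbot : P2 ⊓ MulAction.stabilizer G x0 = ⊥ := by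
    rw [Subgroup.eq_bot_iff_forall]
    rintro k ⟨hk, hkx⟩
    obtain ⟨t1, t2, t3⟩ := hP2' k hk
    have hkn : k ^ (p ^ n) = 1 := by
      rw [← hn]
      have := pow_card_eq_one' (x := (⟨k, t1⟩ : P))
      exact congrArg Subtype.val this
    exact h.triv_of_fix hw he hf he1 hf1 hfe (hPw k t1) t2 t3 hodd hkn hex hfx hx0 hkx
  rw [hbot, Subgroup.card_bot, mul_one] at k3
  rw [← k1, ← k2, ← k3]
  exact mul_dvd_mul c1 c3

theorem class1_dvd (h : X17Core E z ω) {w : V} (hw : w ≠ 0) {e : G} (he : e ∈ x17S E w)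
    (he1 : e ≠ 1) : 1440 ∣ (MulAction.orbit G w).ncard := by
  have h9 : 3 ^ 2 ∣ (MulAction.orbit G w).ncard := by
    refine x17_orbit_part w 3 2 2 Nat.prime_three (dvd_trans ⟨2 ^ 13 * 5, by norm_num⟩ h.cardG) ?_
    intro P hP n hn
    rw [← hn]
    exact h.class1_p hw he he1 Nat.prime_three le_rfl P hP hn
  have h5 : 5 ^ 1 ∣ (MulAction.orbit G w).ncard := by
    refine x17_orbit_part w 5 1 0 Nat.prime_five (dvd_trans ⟨2 ^ 13 * 81, by norm_num⟩ h.cardG) ?_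
    intro P hP n hn
    have h1 := h.class1_p hw he he1 Nat.prime_five (by norm_num) P hP hn
    rw [hn] at h1
    rcases Nat.eq_zero_or_pos n with rfl | h2
    · simp
    · exact absurd (dvd_trans (dvd_pow_self 5 h2.ne') h1) (by decide)
  have h32 : 32 ∣ (MulAction.orbit G w).ncard := by
    refine x17_orb_dvd (K := E) 32 _ ?_ ?_
    · rintro g _ ⟨k, rfl⟩
      exact ⟨g * k, by simp [mul_smul, Subgroup.smul_def]⟩
    · rintro _ ⟨k, rfl⟩
      refine h.E_orb ?_ (h.zneg _)
      exact (smul_ne_zero_iff_ne k).2 hw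
  omega

end X17Core


/-- noncentral involutions. -/
def x17N {G : Type*} [Group G] (E : Subgroup G) (z : G) : Set G :=
  {x | x ∈ E ∧ x * x = 1 ∧ x ≠ 1 ∧ x ≠ z}

namespace X17Core
set_option linter.unusedSectionVars false
variable {G V C : Type*} [Group G] [Finite G] [AddCommGroup V] [Finite V] [DistribMulAction G V]
    [AddCommGroup C] {E : Subgroup G} {z : G} {ω : V → V → C}

theorem N4 (h : X17Core E z ω) : ¬ 4 ∣ (x17N E z).ncard := by
  obtain ⟨u, hu, huu⟩ : ∃ u ∈ E, u * u = z := by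
    by_contra hc
    push Not at hc
    have k1 := h.small E le_rfl (fun x hx => (h.sq x hx).resolve_right (hc x hx))
    rw [h.card] at k1
    omega
  obtain ⟨u1, u2, -, -⟩ := h.u_ne (e := 1) (by simp) huu
  have c64 := h.card64 hu u1 u2
  have k2 := h.half_invol (E ⊓ Subgroup.centralizer {u}) inf_le_left (memCe.2 ⟨hu, rfl⟩)
    (fun x hx => (memCe.1 hx).2) huu
  set J1 := {x | x ∈ (E ⊓ Subgroup.centralizer {u} : Subgroup G) ∧ x * x = 1} with hJ1
  set J2 := {x | x ∈ E ∧ x * u = z * (u * x) ∧ x * x = 1} with hJ2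
  have hord : orderOf u = 4 := by
    refine orderOf_eq_prime_pow (p := 2) (n := 1) ?_ ?_
    · rw [pow_one, pow_two, huu]; exact h.z1
    · exact h.pow4 hu
  have hJ2u : ∀ x ∈ J2, u * x ∈ J2 := by
    rintro x ⟨hx, hxu, hxx⟩
    refine ⟨E.mul_mem hu hx, ?_, ?_⟩
    · calc u * x * u = u * (x * u) := by group
        _ = (u * z) * (u * x) := by rw [hxu]; group
        _ = z * (u * (u * x)) := by rw [h.zc u]; group
    · calc u * x * (u * x) = u * (x * u) * x := by group
        _ = (u * z) * u * (x * x) := by rw [hxu]; group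
        _ = z * (u * u) * (x * x) := by rw [h.zc u]; group
        _ = 1 := by rw [huu, hxx, h.zz, one_mul]
  have h4 : 4 ∣ J2.ncard := by
    refine x17_orb_dvd (K := Subgroup.zpowers u) 4 J2 ?_ ?_
    · rintro ⟨g, hg⟩ x hx
      obtain ⟨n, rfl⟩ := (mem_powers_iff_mem_zpowers).2 hg
      change u ^ n * x ∈ J2
      clear hg
      induction n with
      | zero => simpa using hx
      | succ n ih =>
        rw [pow_succ', mul_assoc]
        exact hJ2u _ ih
    · intro x _
      have k3 : MulAction.orbit (Subgroup.zpowers u) x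
          = (fun y => y * x) '' (Subgroup.zpowers u : Set G) := by
        ext y
        constructor
        · rintro ⟨g, rfl⟩
          exact ⟨g, g.2, rfl⟩
        · rintro ⟨g, hg, rfl⟩
          exact ⟨⟨g, hg⟩, rfl⟩
      rw [k3, Set.ncard_image_of_injective _ (mul_left_injective x)]
      change 4 ∣ Nat.card (Subgroup.zpowers u)
      rw [Nat.card_zpowers, hord]
  have k5 : J1 ∪ J2 = x17N E z ∪ {1, z} := by
    ext x
    simp only [hJ1, hJ2, x17N, Set.mem_union, Set.mem_ofPred_eq, memCe, Set.mem_insert_iff,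
      Set.mem_singleton_iff]
    constructor
    · intro hx
      by_cases x1 : x = 1
      · exact Or.inr (Or.inl x1)
      by_cases x2 : x = z
      · exact Or.inr (Or.inr x2)
      left
      rcases hx with ⟨⟨a, -⟩, b⟩ | ⟨a, -, b⟩ <;> exact ⟨a, b, x1, x2⟩
    · rintro (⟨a, b, -, -⟩ | rfl | rfl)
      · rcases h.comm x a u hu with h5 | h5
        · exact Or.inl ⟨⟨a, h5⟩, b⟩
        · exact Or.inr ⟨a, h5, b⟩
      · exact Or.inl ⟨⟨E.one_mem, by simp⟩, by simp⟩
      · exact Or.inl ⟨⟨h.zE, (h.zc u).symm⟩, h.zz⟩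
  have d1 : Disjoint J1 J2 := by
    rw [Set.disjoint_left]
    rintro x ⟨a, -⟩ ⟨-, b, -⟩
    exact h.anti_ne b (memCe.1 a).2
  have d2 : Disjoint (x17N E z) {1, z} := by
    rw [Set.disjoint_left]
    rintro x ⟨-, -, a, b⟩ (rfl | rfl)
    · exact a rfl
    · exact b rfl
  have k6 := congrArg Set.ncard k5
  rw [Set.ncard_union_eq d1, Set.ncard_union_eq d2, Set.ncard_pair h.z1.symm] at k6
  omega

theorem N_conj (h : X17Core E z ω) (t : G) {x : G} (hx : x ∈ x17N E z) :
    t * x * t⁻¹ ∈ x17N E z := by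
  obtain ⟨a, b, c, d⟩ := hx
  refine ⟨h.nor t x a, ?_, ?_, ?_⟩
  · calc t * x * t⁻¹ * (t * x * t⁻¹) = t * (x * x) * t⁻¹ := by group
      _ = 1 := by rw [b]; group
  · intro h1
    exact c (by simpa using h1)
  · intro h1
    rw [mul_inv_eq_iff_eq_mul, ← h.zc t] at h1
    exact d (mul_left_cancel h1)

theorem split_fix (h : X17Core E z ω) {e f k t : G} (hff : f * f = 1) (hfe : f * e = e * f)
    (hke : k * e = e * k) (hfk : f * k = z * (k * f)) (htk : t * k = k * t)
    (hX : ∀ x : V, e • x = x → f • x = x → t • x = x) {y : V} (hy : e • y = y) : t • y = y := by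
  have h1 : t • (y + f • y) = y + f • y := by
    apply hX
    · rw [smul_add, hy, fix_stable hfe hy]
    · rw [smul_add, ← mul_smul, hff, one_smul, add_comm]
  have hm : f • (y - f • y) = -(y - f • y) := by
    rw [smul_sub, ← mul_smul, hff, one_smul, neg_sub]
  have hem : e • (y - f • y) = y - f • y := by
    rw [smul_sub, hy, fix_stable hfe hy]
  have h2 : t • (y - f • y) = y - f • y := by
    generalize y - f • y = m at hm hem
    have h3 : t • k • m = k • m := by
      apply hX
      · exact fix_stable hke hem
      · rw [← mul_smul, hfk, mul_smul, h.zneg, mul_smul, hm, smul_neg, neg_neg]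
    rw [← mul_smul, htk, mul_smul] at h3
    exact (smul_left_cancel_iff k).1 h3
  have h3 : t • (-((y + f • y) + (y - f • y))) = -((y + f • y) + (y - f • y)) := by
    rw [smul_neg, smul_add, h1, h2]
  have h4 : -((y + f • y) + (y - f • y)) = y := by
    rw [add_add_sub_cancel, h.twice, neg_neg]
  rwa [h4] at h3

theorem class2_T (h : X17Core E z ω) {v : V} (hv : v ≠ 0)
    (hS : ∀ x ∈ E, x • v = v → x = 1) (T : Subgroup G)
    (hT : T ≤ MulAction.stabilizer G v) {n : ℕ} (hn : Nat.card T = 2 ^ n) : Nat.card T ∣ 8 := by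
  have hTv : ∀ t ∈ T, t • v = v := fun t ht => hT ht
  obtain ⟨e, heN, k0⟩ := x17_conj_fix T 2 1 Nat.prime_two n hn (x17N E z)
    (fun t _ x hx => h.N_conj t hx) h.N4
  obtain ⟨heE, hee, he1, hez⟩ := heN
  have hee' : ∀ u : V, e • e • u = u := fun u => by rw [← mul_smul, hee, one_smul]
  have hze1 : z * e ≠ 1 := fun h1 => hez (by rw [eq_inv_of_mul_eq_one_right h1, h.zinv])
  set a := v + e • v with ha
  set b := v - e • v with hb
  have hab : v = -(a + b) := by rw [ha, hb, add_add_sub_cancel, h.twice, neg_neg]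
  have ha0 : a ≠ 0 := by
    intro h1
    apply hze1
    apply hS _ (E.mul_mem h.zE heE)
    rw [mul_smul, h.zneg]
    exact (eq_neg_of_add_eq_zero_left h1).symm
  have hb0 : b ≠ 0 := fun h1 => he1 (hS e heE (sub_eq_zero.1 h1).symm)
  have hea : e • a = a := by rw [ha, smul_add, hee', add_comm]
  have heb : e • b = -b := by rw [hb, smul_sub, hee', neg_sub]
  have hzeb : (z * e) • b = b := by rw [mul_smul, h.zneg, heb, neg_neg]
  have heS : e ∈ x17S E a := memS.2 ⟨heE, hea⟩
  have hzeS : z * e ∈ x17S E b := memS.2 ⟨E.mul_mem h.zE heE, hzeb⟩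
  obtain ⟨f, hf, hf1, hfe⟩ := h.S4 ha0 heS he1
  obtain ⟨k, hk, hk1, hke⟩ := h.S4 hb0 hzeS hze1
  have hcf := h.S_comm ha0 (h.zneg a) hf heS
  have hck := h.S_comm hb0 (h.zneg b) hk hzeS
  have hck' : k * e = e * k := by
    rw [← mul_assoc, h.zc k, mul_assoc, mul_assoc] at hck
    exact mul_left_cancel hck
  have hff := h.S_invol ha0 hf
  have hkk := h.S_invol hb0 hk
  obtain ⟨hfE, hfa⟩ := memS.1 hf
  obtain ⟨hkE, hkb⟩ := memS.1 hk
  have hfk : f * k = z * (k * f) := by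
    refine h.anti_of_ne hfE hkE fun hcom => ?_
    by_cases hka : k • a = -a
    · have h1 : z * (k * e) = 1 := by
        refine hS _ (E.mul_mem h.zE (E.mul_mem hkE heE)) ?_
        have h2 : (z * (k * e)) • a = a := by
          rw [mul_smul, h.zneg, mul_smul, hea, hka, neg_neg]
        have h3 : (z * (k * e)) • b = b := by
          rw [mul_smul, h.zneg, mul_smul, heb, smul_neg, hkb, neg_neg]
        rw [hab, smul_neg, smul_add, h2, h3]
      apply hke
      have h2 := eq_inv_of_mul_eq_one_right h1
      rw [h.zinv] at h2
      rw [← h2, mul_assoc, hee, mul_one]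
    · have hu0 : a + k • a ≠ 0 := fun h1 => hka (eq_neg_of_add_eq_zero_right h1)
      have u1 : e ∈ x17S E (a + k • a) := memS.2 ⟨heE, by
        rw [smul_add, hea, fix_stable hck' hea]⟩
      have u2 : f ∈ x17S E (a + k • a) := memS.2 ⟨hfE, by
        rw [smul_add, hfa, fix_stable hcom.symm hfa]⟩
      have u3 : k ∈ x17S E (a + k • a) := memS.2 ⟨hkE, by
        rw [smul_add, ← mul_smul, hkk, one_smul, add_comm]⟩
      have u4 : k • a = a := by
        rcases h.S_mem hu0 u1 u2 he1 hf1 hfe u3 with h1 | h1 | h1 | h1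
        · rw [h1, one_smul]
        · rw [h1, hea]
        · rw [h1, hfa]
        · rw [h1, mul_smul, hfa, hea]
      apply hk1
      refine hS k hkE ?_
      rw [hab, smul_neg, smul_add, u4, hkb]
  have hkf : k * f = z * (f * k) := by rw [hfk, ← mul_assoc, h.zz, one_mul]
  -- the chain of subgroups
  set T1 := (T ⊓ Subgroup.centralizer {e} : Subgroup G) with hT1
  have hT1' : ∀ t ∈ T1, t ∈ T ∧ t * e = e * t := fun t ht =>
    ⟨ht.1, Subgroup.mem_centralizer_singleton_iff.1 ht.2⟩
  have hT1a : ∀ t ∈ T1, t • a = a ∧ t • b = b ∧ t * (z * e) = z * e * t := by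
    intro t ht
    obtain ⟨t1, t2⟩ := hT1' t ht
    have t3 : t • e • v = e • v := by rw [← mul_smul, t2, mul_smul, hTv t t1]
    refine ⟨by rw [ha, smul_add, t3, hTv t t1], by rw [hb, smul_sub, t3, hTv t t1], ?_⟩
    rw [← mul_assoc, h.zc t, mul_assoc, t2, mul_assoc]
  have d1 : Nat.card T1 ∣ 2 ^ n := by rw [← hn]; exact Subgroup.card_dvd_of_le inf_le_left
  have k1 := x17_conj_orb T1 f
  have s1 : {y | ∃ t ∈ T1, t * f * t⁻¹ = y} ⊆ ({f, e * f} : Set G) := by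
    rintro _ ⟨t, ht, rfl⟩
    rcases h.conj_f ha0 heS hf he1 hf1 hfe (hT1a t ht).1 (hT1' t ht).2 with h1 | h1
    · simp [h1]
    · simp [h1]
  have c1 : {y | ∃ t ∈ T1, t * f * t⁻¹ = y}.ncard ∣ 2 := by
    refine x17_pow_small2 (n := n) (dvd_trans ?_ d1) ?_
    · rw [← k1]; exact dvd_mul_right _ _
    · refine (Set.ncard_le_ncard s1 (Set.toFinite _)).trans ?_
      have := Set.ncard_insert_le f {e * f}
      rw [Set.ncard_singleton] at this
      omega
  set T2 := (T1 ⊓ Subgroup.centralizer {f} : Subgroup G) with hT2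
  have k2 := x17_conj_orb T2 k
  have s2 : {y | ∃ t ∈ T2, t * k * t⁻¹ = y} ⊆ ({k, z * e * k} : Set G) := by
    rintro _ ⟨t, ht, rfl⟩
    rcases h.conj_f hb0 hzeS hk hze1 hk1 hke (hT1a t ht.1).2.1 (hT1a t ht.1).2.2 with h1 | h1
    · simp [h1]
    · simp [h1]
  have c2 : {y | ∃ t ∈ T2, t * k * t⁻¹ = y}.ncard ∣ 2 := by
    refine x17_pow_small2 (n := n) (dvd_trans ?_ d1) ?_
    · refine dvd_trans ?_ (Subgroup.card_dvd_of_le (inf_le_left : T2 ≤ T1))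
      rw [← k2]; exact dvd_mul_right _ _
    · refine (Set.ncard_le_ncard s2 (Set.toFinite _)).trans ?_
      have := Set.ncard_insert_le k {z * e * k}
      rw [Set.ncard_singleton] at this
      omega
  have hbot : (T2 ⊓ Subgroup.centralizer {k} : Subgroup G) = ⊥ := by
    rw [Subgroup.eq_bot_iff_forall]
    rintro t ⟨ht, htk⟩
    have htf := Subgroup.mem_centralizer_singleton_iff.1 ht.2
    replace htk := Subgroup.mem_centralizer_singleton_iff.1 htk
    obtain ⟨tT, te⟩ := hT1' t ht.1
    obtain ⟨ta, tb, tze⟩ := hT1a t ht.1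
    have htn : t ^ (2 ^ n) = 1 := by
      rw [← hn]
      exact congrArg Subtype.val (pow_card_eq_one' (x := (⟨t, tT⟩ : T)))
    have hcop : Nat.Coprime (2 ^ n) 3 := Nat.Coprime.pow_left n (by norm_num)
    have f1 : ∀ y : V, e • y = y → t • y = y := fun y hy =>
      h.split_fix hff hcf hck' hfk htk (fun x x1 x2 =>
        h.omega_triv ha0 heS hf he1 hf1 hfe ta te htf hcop htn x1 x2) hy
    have hfze : f * (z * e) = z * e * f := by
      rw [← mul_assoc, h.zc f, mul_assoc, hcf, mul_assoc]
    have f2 : ∀ y : V, (z * e) • y = y → t • y = y := fun y hy =>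
      h.split_fix hkk hck hfze hkf htf (fun x x1 x2 =>
        h.omega_triv hb0 hzeS hk hze1 hk1 hke tb tze htk hcop htn x1 x2) hy
    refine h.faith t n htn fun y => ?_
    have g1 : t • (y + e • y) = y + e • y := f1 _ (by rw [smul_add, hee', add_comm])
    have g2 : t • (y - e • y) = y - e • y := f2 _ (by
      rw [mul_smul, h.zneg, smul_sub, hee', neg_sub])
    have h3 : t • (-((y + e • y) + (y - e • y))) = -((y + e • y) + (y - e • y)) := by
      rw [smul_neg, smul_add, g1, g2]
    have h4 : -((y + e • y) + (y - e • y)) = y := by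
      rw [add_add_sub_cancel, h.twice, neg_neg]
    rwa [h4] at h3
  rw [hbot, Subgroup.card_bot, mul_one] at k2
  refine dvd_trans k0 ?_
  rw [← k1, ← k2]
  exact mul_dvd_mul (dvd_refl (2 ^ 1)) (mul_dvd_mul c1 c2)

theorem class2_dvd (h : X17Core E z ω) {v : V} (hv : v ≠ 0)
    (hS : ∀ x ∈ E, x • v = v → x = 1) : 1024 ∣ (MulAction.orbit G v).ncard := by
  refine x17_orbit_part v 2 10 3 Nat.prime_two (dvd_trans ⟨81 * 5, by norm_num⟩ h.cardG) ?_
  intro P hP n hn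
  rw [← hn]
  exact h.class2_T hv hS P hP hn

end X17Core


namespace X17Core
set_option linter.unusedSectionVars false
variable {G V C : Type*} [Group G] [Finite G] [AddCommGroup V] [Finite V] [DistribMulAction G V]
    [AddCommGroup C] {E : Subgroup G} {z : G} {ω : V → V → C}

theorem S_move (h : X17Core E z ω) {v : V} (g : G) {x : G} (hx : x ∈ x17S E v) :
    g * x * g⁻¹ ∈ x17S E (g • v) := by
  obtain ⟨h1, h2⟩ := memS.1 hx
  refine memS.2 ⟨h.nor g x h1, ?_⟩
  rw [mul_smul, mul_smul, inv_smul_smul, h2]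

theorem A1_move (h : X17Core E z ω) {v : V} (g : G) (hv : ∃ e ∈ x17S E v, e ≠ 1) :
    ∃ e ∈ x17S E (g • v), e ≠ 1 := by
  obtain ⟨e, he, he1⟩ := hv
  exact ⟨_, h.S_move g he, fun h1 => he1 (by simpa using h1)⟩

theorem A1_move' (h : X17Core E z ω) {v : V} (g : G) (hv : ∃ e ∈ x17S E (g • v), e ≠ 1) :
    ∃ e ∈ x17S E v, e ≠ 1 := by
  have := h.A1_move g⁻¹ hv
  rwa [inv_smul_smul] at this

theorem not_A1 {v : V} (hv : ¬ ∃ e ∈ x17S E v, e ≠ 1) : ∀ x ∈ E, x • v = v → x = 1 := by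
  intro x hx hxv
  by_contra h1
  exact hv ⟨x, memS.2 ⟨hx, hxv⟩, h1⟩

theorem counts (h : X17Core E z ω) :
    {v : V | v ≠ 0 ∧ ∃ e ∈ x17S E v, e ≠ 1}.ncard = 1440 ∧
    {v : V | v ≠ 0 ∧ ¬ ∃ e ∈ x17S E v, e ≠ 1}.ncard = 5120 := by
  set A1 := {v : V | v ≠ 0 ∧ ∃ e ∈ x17S E v, e ≠ 1} with hA1
  set A2 := {v : V | v ≠ 0 ∧ ¬ ∃ e ∈ x17S E v, e ≠ 1} with hA2
  have h1 : 1440 ∣ A1.ncard := by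
    refine x17_orb_dvd (K := G) 1440 A1 ?_ ?_
    · rintro g v ⟨hv, hv'⟩
      exact ⟨(smul_ne_zero_iff_ne g).2 hv, h.A1_move g hv'⟩
    · rintro v ⟨hv, e, he, he1⟩
      exact h.class1_dvd hv he he1
  have h2 : 1024 ∣ A2.ncard := by
    refine x17_orb_dvd (K := G) 1024 A2 ?_ ?_
    · rintro g v ⟨hv, hv'⟩
      exact ⟨(smul_ne_zero_iff_ne g).2 hv, fun h3 => hv' (h.A1_move' g h3)⟩
    · rintro v ⟨hv, hv'⟩
      exact h.class2_dvd hv (not_A1 hv')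
  have h3 : A1 ∪ A2 = {0}ᶜ := by
    ext v
    simp only [hA1, hA2, Set.mem_union, Set.mem_ofPred_eq, Set.mem_compl_iff,
      Set.mem_singleton_iff]
    rw [← and_or_left, and_iff_left (Classical.em _)]
  have h4 : Disjoint A1 A2 := by
    rw [Set.disjoint_left]
    rintro v ⟨-, a⟩ ⟨-, b⟩
    exact b a
  have h5 := congrArg Set.ncard h3
  rw [Set.ncard_union_eq h4] at h5
  have h6 := Set.ncard_add_ncard_compl ({0} : Set V)
  rw [Set.ncard_singleton, h.cardV] at h6
  omega

theorem N54 (h : X17Core E z ω) : (x17N E z).ncard = 54 := by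
  obtain ⟨c1, -⟩ := h.counts
  set A1 := {v : V | v ≠ 0 ∧ ∃ e ∈ x17S E v, e ≠ 1} with hA1
  have r1 : ∀ x ∈ x17N E z, {b | b ∈ A1 ∧ x • b = b}.ncard = 80 := by
    rintro x ⟨hx, hxx, hx1, hxz⟩
    have k1 : {b | b ∈ A1 ∧ x • b = b} = ((x17F x : AddSubgroup V) : Set V) \ {0} := by
      ext v
      simp only [hA1, Set.mem_ofPred_eq, Set.mem_sdiff, SetLike.mem_coe, memF,
        Set.mem_singleton_iff]
      constructor
      · rintro ⟨⟨a, -⟩, b⟩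
        exact ⟨b, a⟩
      · rintro ⟨b, a⟩
        exact ⟨⟨a, x, memS.2 ⟨hx, b⟩, hx1⟩, b⟩
    have k3 := Set.ncard_sdiff_add_ncard_of_subset (s := {0})
      (t := ((x17F x : AddSubgroup V) : Set V)) (by
        rintro v rfl
        exact AddSubgroup.zero_mem _)
    have k4 : ((x17F x : AddSubgroup V) : Set V).ncard = 81 := h.card81 hx hxx hx1 hxz
    rw [← k1, k4, Set.ncard_singleton] at k3
    omega
  have r2 : ∀ v ∈ A1, {a | a ∈ x17N E z ∧ a • v = v}.ncard = 3 := by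
    rintro v ⟨hv, e, he, he1⟩
    obtain ⟨f, hf, hf1, hfe⟩ := h.S4 hv he he1
    have k0 := h.four hv he hf he1 hf1 hfe
    have k1 : {a | a ∈ x17N E z ∧ a • v = v} = {e, f, e * f} := by
      ext x
      constructor
      · rintro ⟨⟨a, b, c, d⟩, k⟩
        rcases h.S_mem hv he hf he1 hf1 hfe (memS.2 ⟨a, k⟩) with h1 | h1 | h1 | h1
        · exact absurd h1 c
        · simp [h1]
        · simp [h1]
        · simp [h1]
      · intro hx
        have k2 : x ∈ x17S E v := by
          have : x ∈ ((x17S E v : Subgroup G) : Set G) := by rw [k0]; exact Or.inr hx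
          exact this
        refine ⟨⟨(memS.1 k2).1, h.S_invol hv k2, ?_, h.S_ne_z hv (memS.1 k2).2⟩, (memS.1 k2).2⟩
        rintro rfl
        rcases hx with h1 | h1 | h1
        · exact he1 h1.symm
        · exact hf1 h1.symm
        · have h2 := eq_inv_of_mul_eq_one_right (h1 : 1 = e * f).symm
          exact hfe (by rw [h2, inv_eq_of_mul_eq_one_left (h.S_invol hv he)])
    rw [k1, Set.ncard_insert_of_notMem, Set.ncard_pair]
    · intro h3
      exact he1 (by simpa using h3.symm)
    · simp only [Set.mem_insert_iff, Set.mem_singleton_iff, not_or]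
      exact ⟨hfe.symm, fun h3 => hf1 (by simpa using h3.symm)⟩
  have d1 := x17_dc (x17N E z) A1 (fun x v => x • v = v) 80 3 (fun a ha => (r1 a ha).ge)
    (fun b hb => (r2 b hb).le)
  have d2 := x17_dc A1 (x17N E z) (fun v x => x • v = v) 3 80 (fun a ha => (r2 a ha).ge)
    (fun b hb => (r1 b hb).le)
  omega

theorem class2_five (h : X17Core E z ω) {v : V} (hS : ∀ x ∈ E, x • v = v → x = 1)
    (P : Subgroup G) (hP : P ≤ MulAction.stabilizer G v) {n : ℕ} (hn : Nat.card P = 5 ^ n) :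
    5 ^ n ∣ 5 ^ 0 := by
  obtain ⟨e, heN, k0⟩ := x17_conj_fix P 5 0 Nat.prime_five n hn (x17N E z)
    (fun t _ x hx => h.N_conj t hx) (by rw [h.N54]; decide)
  obtain ⟨heE, hee, he1, hez⟩ := heN
  have hze1 : z * e ≠ 1 := fun h1 => hez (by rw [eq_inv_of_mul_eq_one_right h1, h.zinv])
  have ha0 : v + e • v ≠ 0 := by
    intro h1
    apply hze1
    apply hS _ (E.mul_mem h.zE heE)
    rw [mul_smul, h.zneg]
    exact (eq_neg_of_add_eq_zero_left h1).symm
  have hea : e • (v + e • v) = v + e • v := by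
    rw [smul_add, ← mul_smul, hee, one_smul, add_comm]
  rw [pow_zero, one_mul] at k0
  have k1 := Nat.dvd_antisymm k0 (Subgroup.card_dvd_of_le inf_le_left)
  have k2 := h.class1_p ha0 (memS.2 ⟨heE, hea⟩) he1 Nat.prime_five (by norm_num)
    (P ⊓ Subgroup.centralizer {e}) (by
      rintro t ⟨ht, hte⟩
      replace hte := Subgroup.mem_centralizer_singleton_iff.1 hte
      have htv : t • v = v := hP ht
      rw [MulAction.mem_stabilizer_iff, smul_add, ← mul_smul, hte, mul_smul, htv])
    (n := n) (by rw [← k1, hn])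
  rw [← k1, hn] at k2
  rcases Nat.eq_zero_or_pos n with rfl | h2
  · simp
  · exact absurd (dvd_trans (dvd_pow_self 5 h2.ne') k2) (by decide)

theorem main (h : X17Core E z ω) : ∃ a b : V, a ≠ 0 ∧ b ≠ 0 ∧ (¬ ∃ g : G, g • a = b) ∧
    ∀ v : V, v ≠ 0 → (∃ g : G, g • a = v) ∨ ∃ g : G, g • b = v := by
  obtain ⟨c1, c2⟩ := h.counts
  set A1 := {v : V | v ≠ 0 ∧ ∃ e ∈ x17S E v, e ≠ 1} with hA1
  set A2 := {v : V | v ≠ 0 ∧ ¬ ∃ e ∈ x17S E v, e ≠ 1} with hA2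
  obtain ⟨a, ha⟩ : A1.Nonempty := Set.nonempty_of_ncard_ne_zero (by rw [c1]; norm_num)
  obtain ⟨b, hb⟩ : A2.Nonempty := Set.nonempty_of_ncard_ne_zero (by rw [c2]; norm_num)
  have o1 : MulAction.orbit G a = A1 := by
    apply Set.eq_of_subset_of_ncard_le
    · rintro _ ⟨g, rfl⟩
      exact ⟨(smul_ne_zero_iff_ne g).2 ha.1, h.A1_move g ha.2⟩
    · rw [c1]
      obtain ⟨e, he, he1⟩ := ha.2
      exact Nat.le_of_dvd ((Set.ncard_pos (Set.toFinite _)).2 ⟨a, MulAction.mem_orbit_self a⟩)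
        (h.class1_dvd ha.1 he he1)
    · exact Set.toFinite _
  have o2 : MulAction.orbit G b = A2 := by
    apply Set.eq_of_subset_of_ncard_le
    · rintro _ ⟨g, rfl⟩
      exact ⟨(smul_ne_zero_iff_ne g).2 hb.1, fun h3 => hb.2 (h.A1_move' g h3)⟩
    · rw [c2]
      have d1 := h.class2_dvd hb.1 (not_A1 hb.2)
      have d2 : 5 ^ 1 ∣ (MulAction.orbit G b).ncard :=
        x17_orbit_part b 5 1 0 Nat.prime_five (dvd_trans ⟨2 ^ 13 * 81, by norm_num⟩ h.cardG)
          (fun P hP n hn => h.class2_five (not_A1 hb.2) P hP hn)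
      have d3 : 0 < (MulAction.orbit G b).ncard :=
        (Set.ncard_pos (Set.toFinite _)).2 ⟨b, MulAction.mem_orbit_self b⟩
      omega
    · exact Set.toFinite _
  refine ⟨a, b, ha.1, hb.1, ?_, ?_⟩
  · rintro ⟨g, hg⟩
    apply hb.2
    rw [← hg]
    exact h.A1_move g ha.2
  · intro v hv
    by_cases h1 : ∃ e ∈ x17S E v, e ≠ 1
    · left
      have : v ∈ A1 := ⟨hv, h1⟩
      rwa [← o1] at this
    · right
      have : v ∈ A2 := ⟨hv, h1⟩
      rwa [← o2] at this

end X17Core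

theorem x17_sp_five : 5 ∣ Nat.card Sp43 := by
  let M : Matrix (Fin 2 ⊕ Fin 2) (Fin 2 ⊕ Fin 2) (ZMod 3) :=
    Matrix.fromBlocks !![2, 1; 2, 0] !![0, 0; 1, 1] !![0, 0; 2, 0] !![0, 1; 0, 0]
  have hM : M ∈ Sp43 := SymplecticGroup.fromBlocks_mem_iff.2 (by decide)
  have h5 : M ^ 5 = 1 := by
    have : M ^ 5 = (M * M) * (M * M) * M := by simp [pow_succ, mul_assoc]
    rw [this]
    simp only [M, Matrix.fromBlocks_multiply, ← Matrix.fromBlocks_one, Matrix.fromBlocks_inj]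
    decide
  have h1 : M ≠ 1 := by
    intro h
    simp only [M, ← Matrix.fromBlocks_one, Matrix.fromBlocks_inj] at h
    revert h
    decide
  have : Fact (Nat.Prime 5) := ⟨Nat.prime_five⟩
  have ho : orderOf (⟨M, hM⟩ : Sp43) = 5 := by
    apply orderOf_eq_prime
    · exact Subtype.ext h5
    · intro h
      exact h1 (congrArg Subtype.val h)
  rw [← ho]
  exact orderOf_dvd_natCard _

def x17U (p : ZMod 3 × ZMod 3 × ZMod 3 × ZMod 3) :
    Matrix (Fin 2 ⊕ Fin 2) (Fin 2 ⊕ Fin 2) (ZMod 3) :=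
  Matrix.fromBlocks !![1, p.1; 0, 1] !![p.2.1 + p.1 * p.2.2.1, p.2.2.1 + p.1 * p.2.2.2;
    p.2.2.1, p.2.2.2] 0 !![1, 0; -p.1, 1]

theorem x17U_mem (p) : x17U p ∈ Sp43 := by
  refine SymplecticGroup.fromBlocks_mem_iff.2 ⟨by simp, ?_, ?_⟩
  · ext i j
    fin_cases i <;> fin_cases j <;> simp [Matrix.mul_apply, Fin.sum_univ_two] <;> ring
  · ext i j
    fin_cases i <;> fin_cases j <;> simp [Matrix.mul_apply, Fin.sum_univ_two]

theorem x17U_mul (a b c d a' b' c' d') : x17U (a, b, c, d) * x17U (a', b', c', d')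
    = x17U (a + a', b' + b - 2 * a' * c + a' ^ 2 * d, c' + c - a' * d, d + d') := by
  simp only [x17U, Matrix.fromBlocks_multiply, Matrix.fromBlocks_inj]
  refine ⟨?_, ?_, by simp, ?_⟩ <;>
  · ext i j
    fin_cases i <;> fin_cases j <;> simp [Matrix.mul_apply, Fin.sum_univ_two] <;> ring

theorem x17U_one : x17U (0, 0, 0, 0) = 1 := by
  simp only [x17U, ← Matrix.fromBlocks_one, Matrix.fromBlocks_inj]
  refine ⟨?_, ?_, trivial, ?_⟩ <;>
  · ext i j
    fin_cases i <;> fin_cases j <;> simp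

theorem x17U_inj : Function.Injective x17U := by
  rintro ⟨a, b, c, d⟩ ⟨a', b', c', d'⟩ h
  simp only [x17U, Matrix.fromBlocks_inj] at h
  obtain ⟨h1, h2, -, -⟩ := h
  have e1 := congrFun (congrFun h1 0) 1
  have e2 := congrFun (congrFun h2 0) 0
  have e3 := congrFun (congrFun h2 1) 0
  have e4 := congrFun (congrFun h2 1) 1
  simp at e1 e2 e3 e4
  subst e1 e3 e4
  simpa using e2

theorem x17_sp_81 : 81 ∣ Nat.card Sp43 := by
  let f : ZMod 3 × ZMod 3 × ZMod 3 × ZMod 3 → Sp43 := fun p => ⟨x17U p, x17U_mem p⟩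
  have hinv : ∀ a b c d, f (a, b, c, d)
      * f (-a, -(b + 2 * a * c + a ^ 2 * d), -(c + a * d), -d) = 1 := by
    intro a b c d
    apply Subtype.ext
    change x17U _ * x17U _ = 1
    rw [x17U_mul, ← x17U_one]
    congr 1
    ext <;> simp <;> ring
  let U : Subgroup Sp43 :=
    { carrier := Set.range f
      one_mem' := ⟨(0, 0, 0, 0), Subtype.ext x17U_one⟩
      mul_mem' := by
        rintro _ _ ⟨⟨a, b, c, d⟩, rfl⟩ ⟨⟨a', b', c', d'⟩, rfl⟩
        exact ⟨_, Subtype.ext (x17U_mul a b c d a' b' c' d').symm⟩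
      inv_mem' := by
        rintro _ ⟨⟨a, b, c, d⟩, rfl⟩
        exact ⟨_, (inv_eq_of_mul_eq_one_right (hinv a b c d)).symm⟩ }
  have hinj : Function.Injective f := fun p q h => x17U_inj (congrArg Subtype.val h)
  have hc : Nat.card U = 81 := by
    change Nat.card (Set.range f) = 81
    rw [Nat.card_range_of_injective hinj]
    simp
  rw [← hc]
  exact Subgroup.card_subgroup_dvd_card U

theorem x17_sl_card : Nat.card (Matrix.SpecialLinearGroup (Fin 2) (ZMod 3)) = 24 := by
  rw [Nat.card_eq_fintype_card]
  decide +kernel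

def x17B (g : Fin 2 → Matrix.SpecialLinearGroup (Fin 2) (ZMod 3)) :
    Matrix (Fin 2 ⊕ Fin 2) (Fin 2 ⊕ Fin 2) (ZMod 3) :=
  Matrix.fromBlocks (Matrix.diagonal fun i => (g i).1 0 0) (Matrix.diagonal fun i => (g i).1 0 1)
    (Matrix.diagonal fun i => (g i).1 1 0) (Matrix.diagonal fun i => (g i).1 1 1)

theorem x17B_mem (g) : x17B g ∈ Sp43 := by
  refine SymplecticGroup.fromBlocks_mem_iff.2 ⟨?_, ?_, ?_⟩
  · simp [mul_comm]
  · simp [mul_comm]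
  · simp only [Matrix.diagonal_transpose, Matrix.diagonal_mul_diagonal, Matrix.diagonal_sub,
      ← Matrix.diagonal_one]
    congr 1
    funext i
    have := (g i).2
    rw [Matrix.det_fin_two] at this
    refine Eq.trans ?_ this
    ring

theorem x17B_mul (g h) : x17B (g * h) = x17B g * x17B h := by
  simp only [x17B, Matrix.fromBlocks_multiply, Matrix.fromBlocks_inj,
    Matrix.diagonal_mul_diagonal, Matrix.diagonal_add]
  refine ⟨?_, ?_, ?_, ?_⟩ <;>
  · congr 1
    funext i
    simp [Matrix.mul_apply, Fin.sum_univ_two]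

theorem x17B_one : x17B 1 = 1 := by
  simp [x17B]

theorem x17B_inj : Function.Injective x17B := by
  intro g h hgh
  simp only [x17B, Matrix.fromBlocks_inj] at hgh
  obtain ⟨h1, h2, h3, h4⟩ := hgh
  have e1 := Matrix.diagonal_injective h1
  have e2 := Matrix.diagonal_injective h2
  have e3 := Matrix.diagonal_injective h3
  have e4 := Matrix.diagonal_injective h4
  funext i
  apply Subtype.ext
  ext a b
  fin_cases a <;> fin_cases b
  · exact congrFun e1 i
  · exact congrFun e2 i
  · exact congrFun e3 i
  · exact congrFun e4 i

theorem x17_double {G : Type*} [Group G] [Finite G] (L : Subgroup G) (s : G) (hs : s * s = 1)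
    (hsL : s ∉ L) (hn : ∀ x ∈ L, s * x * s ∈ L) : 2 * Nat.card L ∣ Nat.card G := by
  have hs' : s⁻¹ = s := inv_eq_of_mul_eq_one_left hs
  have key : ∀ x, s * x ∈ L → x * s ∈ L := by
    intro x hx
    have := hn _ hx
    rwa [← mul_assoc, hs, one_mul] at this
  have key' : ∀ x, x * s ∈ L → s * x ∈ L := by
    intro x hx
    have := hn _ hx
    rwa [mul_assoc, mul_assoc, hs, mul_one] at this
  let K : Subgroup G :=
    { carrier := {x | x ∈ L ∨ s * x ∈ L}
      one_mem' := Or.inl L.one_mem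
      mul_mem' := by
        rintro a b (ha | ha) (hb | hb)
        · exact Or.inl (L.mul_mem ha hb)
        · right
          have := L.mul_mem (hn a ha) hb
          rwa [mul_assoc, ← mul_assoc s s, hs, one_mul, mul_assoc] at this
        · right
          rw [← mul_assoc]
          exact L.mul_mem ha hb
        · left
          have := L.mul_mem (key a ha) hb
          rwa [mul_assoc, ← mul_assoc s s, hs, one_mul] at this
      inv_mem' := by
        rintro a (ha | ha)
        · exact Or.inl (L.inv_mem ha)
        · right
          have := L.inv_mem (key a ha)
          rwa [mul_inv_rev, hs'] at this }
  have h1 := x17_index2 K L (fun x hx => Or.inl hx) s (Or.inr (by rw [hs]; exact L.one_mem)) hsL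
    (fun x hx => hx)
  rw [← h1]
  exact Subgroup.card_subgroup_dvd_card K

theorem x17_sp_128 : 128 ∣ Nat.card Sp43 := by
  let f : (Fin 2 → Matrix.SpecialLinearGroup (Fin 2) (ZMod 3)) →* Sp43 :=
    { toFun := fun g => ⟨x17B g, x17B_mem g⟩
      map_one' := Subtype.ext x17B_one
      map_mul' := fun g h => Subtype.ext (x17B_mul g h) }
  have hinj : Function.Injective f := fun p q h => x17B_inj (congrArg Subtype.val h)
  have hc : Nat.card f.range = 576 := by
    rw [← Nat.card_congr (MonoidHom.ofInjective hinj).toEquiv, Nat.card_fun, x17_sl_card]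
    simp
  let P : Matrix (Fin 2) (Fin 2) (ZMod 3) := !![0, 1; 1, 0]
  have hPP : P * P = 1 := by decide
  have hPd : ∀ d : Fin 2 → ZMod 3, P * Matrix.diagonal d * P
      = Matrix.diagonal fun i => d (Equiv.swap 0 1 i) := by
    intro d
    ext i j
    fin_cases i <;> fin_cases j <;> 
      simp [P, Matrix.mul_apply, Fin.sum_univ_two, Matrix.vecMul_diagonal]
  let S : Matrix (Fin 2 ⊕ Fin 2) (Fin 2 ⊕ Fin 2) (ZMod 3) := Matrix.fromBlocks P 0 0 P
  have hS : S ∈ Sp43 := SymplecticGroup.fromBlocks_mem_iff.2 (by decide)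
  have hSS : S * S = 1 := by
    simp only [S, Matrix.fromBlocks_multiply, ← Matrix.fromBlocks_one, Matrix.fromBlocks_inj]
    simp [hPP]
  have h2 := x17_double f.range ⟨S, hS⟩ (Subtype.ext hSS) (by
      rintro ⟨g, hg⟩
      have h1 : x17B g = S := congrArg Subtype.val hg
      simp only [x17B, S, Matrix.fromBlocks_inj] at h1
      have h2 := congrFun (congrFun h1.1 0) 1
      simp [P] at h2) (by
      rintro _ ⟨g, rfl⟩
      refine ⟨fun i => g (Equiv.swap 0 1 i), Subtype.ext ?_⟩
      change x17B _ = S * x17B g * S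
      simp only [x17B, S, Matrix.fromBlocks_multiply, Matrix.fromBlocks_inj]
      simp [hPd])
  rw [hc] at h2
  exact dvd_trans ⟨9, by norm_num⟩ h2

theorem x17_sp_center : Nat.card (Subgroup.center Sp43) ∣ 2 := by
  have hX : ∀ X : Matrix (Fin 2) (Fin 2) (ZMod 3), X.transpose = X →
      Matrix.fromBlocks 1 X 0 1 ∈ Sp43 := fun X hX =>
    SymplecticGroup.fromBlocks_mem_iff.2 ⟨by simp, by simp [hX], by simp⟩
  have hY : Matrix.fromBlocks 1 0 1 1 ∈ Sp43 :=
    SymplecticGroup.fromBlocks_mem_iff.2 ⟨by simp, by simp, by simp⟩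
  have hneg : (-1 : Matrix (Fin 2 ⊕ Fin 2) (Fin 2 ⊕ Fin 2) (ZMod 3)) ∈ Sp43 :=
    SymplecticGroup.neg_mem Sp43.one_mem
  have hsub : ((Subgroup.center Sp43 : Subgroup Sp43) : Set Sp43) ⊆ {1, ⟨-1, hneg⟩} := by
    rintro ⟨M, hM⟩ hMc
    have hcomm : ∀ N : Sp43, N.1 * M = M * N.1 := fun N =>
      congrArg Subtype.val (Subgroup.mem_center_iff.1 hMc N)
    obtain ⟨A, B, C, D, rfl⟩ : ∃ A B C D, M = Matrix.fromBlocks A B C D :=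
      ⟨_, _, _, _, (Matrix.fromBlocks_toBlocks M).symm⟩
    have hXc : ∀ X : Matrix (Fin 2) (Fin 2) (ZMod 3), X.transpose = X → X * C = 0 ∧ X * D = A * X := by
      intro X hX'
      have := hcomm ⟨_, hX X hX'⟩
      simp only [Matrix.fromBlocks_multiply, Matrix.fromBlocks_inj] at this
      obtain ⟨h1, h2, -, -⟩ := this
      simp only [one_mul, mul_one, mul_zero, add_zero] at h1 h2
      refine ⟨by simpa using h1, ?_⟩
      rw [add_comm] at h2
      exact add_right_cancel h2
    have hYc := hcomm ⟨_, hY⟩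
    simp only [Matrix.fromBlocks_multiply, Matrix.fromBlocks_inj] at hYc
    have hB : B = 0 := by
      have := hYc.1
      simpa using this.symm
    have hC : C = 0 := by simpa using (hXc 1 (by simp)).1
    have hD : D = A := by simpa using (hXc 1 (by simp)).2
    subst hB hC hD
    have k1 := (hXc !![1, 0; 0, 0] (by decide)).2
    have k2 := (hXc !![0, 1; 1, 0] (by decide)).2
    have hm := (SymplecticGroup.fromBlocks_mem_iff.1 hM).2.2
    have fin : ∀ D : Matrix (Fin 2) (Fin 2) (ZMod 3),
        !![1, 0; 0, 0] * D = D * !![1, 0; 0, 0] → !![0, 1; 1, 0] * D = D * !![0, 1; 1, 0] →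
        D.transpose * D - (0 : Matrix (Fin 2) (Fin 2) (ZMod 3)).transpose * 0 = 1 → D = 1 ∨ D = -1 := by decide +kernel
    rcases fin D k1 k2 hm with rfl | rfl
    · left
      exact Subtype.ext Matrix.fromBlocks_one
    · right
      refine Subtype.ext ?_
      change _ = -1
      rw [← Matrix.fromBlocks_one, Matrix.fromBlocks_neg]
      simp
  have h1 := Set.ncard_le_ncard hsub (Set.toFinite _)
  have h2 : ({1, ⟨-1, hneg⟩} : Set Sp43).ncard ≤ 2 := by
    have := Set.ncard_insert_le (1 : Sp43) {⟨-1, hneg⟩}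
    rw [Set.ncard_singleton] at this
    omega
  have h3 : Nat.card (Subgroup.center Sp43) ≤ 2 := h1.trans h2
  have h4 : 0 < Nat.card (Subgroup.center Sp43) := Nat.card_pos
  interval_cases Nat.card (Subgroup.center Sp43) <;> decide

theorem x17_psp : 64 * 81 * 5 ∣ Nat.card PSp43 := by
  have h1 := Subgroup.card_eq_card_quotient_mul_card_subgroup (Subgroup.center Sp43)
  have h2 : Nat.card Sp43 ∣ Nat.card PSp43 * 2 := by
    rw [h1]
    exact mul_dvd_mul_left _ x17_sp_center
  have a := x17_sp_five.trans h2
  have b := x17_sp_81.trans h2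
  have c := x17_sp_128.trans h2
  omega

universe u

instance x17CenComm (H : Type*) [Group H] : CommGroup (Subgroup.center H) :=
  { (inferInstance : Group (Subgroup.center H)) with
    mul_comm := fun a b => Subtype.ext (Subgroup.mem_center_iff.1 b.2 a.1) }

open scoped commutatorElement in
theorem x17_E {G : Type*} [Group G] [Finite G] (E : Subgroup G) [hE : E.Normal]
    (h : IsExtraspecial 2 E) : ∃ z : G, z ∈ E ∧ z ≠ 1 ∧ z * z = 1 ∧ (∀ g, g * z = z * g) ∧
      (∀ x ∈ E, x * x = 1 ∨ x * x = z) ∧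
      (∀ x ∈ E, ∀ y ∈ E, x * y = y * x ∨ x * y = z * (y * x)) ∧
      (∀ x ∈ E, (∀ y ∈ E, x * y = y * x) → x = 1 ∨ x = z) := by
  obtain ⟨-, hcc, -, hcard⟩ := h
  obtain ⟨u, v, huv, huniv⟩ := Nat.card_eq_two_iff.1 hcard
  obtain ⟨z, hz1, hz⟩ : ∃ z : Subgroup.center E, z ≠ 1 ∧ ∀ w, w = 1 ∨ w = z := by
    have hall : ∀ w, w = u ∨ w = v := fun w => by
      have : w ∈ ({u, v} : Set (Subgroup.center E)) := by rw [huniv]; trivial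
      simpa using this
    rcases hall 1 with h1 | h1
    · exact ⟨v, by rw [h1]; exact huv.symm, fun w => by rw [h1]; exact hall w⟩
    · exact ⟨u, by rw [h1]; exact huv, fun w => by rw [h1]; exact (hall w).symm⟩
  have cen : ∀ x ∈ E, (∀ y ∈ E, x * y = y * x) → x = 1 ∨ x = z.1.1 := by
    intro x hx hxy
    have hm : (⟨x, hx⟩ : E) ∈ Subgroup.center E :=
      Subgroup.mem_center_iff.2 fun y => Subtype.ext (hxy y.1 y.2).symm
    rcases hz ⟨_, hm⟩ with h1 | h1
    · exact Or.inl (congrArg (fun w : Subgroup.center E => w.1.1) h1)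
    · exact Or.inr (congrArg (fun w : Subgroup.center E => w.1.1) h1)
  have zc : ∀ y ∈ E, z.1.1 * y = y * z.1.1 := fun y hy =>
    (congrArg Subtype.val (Subgroup.mem_center_iff.1 z.2 ⟨y, hy⟩)).symm
  have z1 : z.1.1 ≠ 1 := fun h => hz1 (Subtype.ext (Subtype.ext h))
  have zE : z.1.1 ∈ E := z.1.2
  have zz : z.1.1 * z.1.1 = 1 := by
    rcases cen (z.1.1 * z.1.1) (E.mul_mem zE zE)
      (fun y hy => by rw [mul_assoc, zc y hy, ← mul_assoc, zc y hy, mul_assoc]) with h1 | h1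
    · exact h1
    · exact absurd (mul_eq_left.1 h1) z1
  have comm : ∀ x ∈ E, ∀ y ∈ E, x * y = y * x ∨ x * y = z.1.1 * (y * x) := by
    intro x hx y hy
    have hm : ⁅(⟨x, hx⟩ : E), (⟨y, hy⟩ : E)⁆ ∈ Subgroup.center E := by
      rw [hcc]
      exact Subgroup.commutator_mem_commutator (Subgroup.mem_top _) (Subgroup.mem_top _)
    have h2 : ∀ w : G, x * y * x⁻¹ * y⁻¹ = w → x * y = w * (y * x) := by
      rintro w rfl
      group
    rcases hz ⟨_, hm⟩ with h1 | h1
    · left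
      simpa using h2 _ (congrArg (fun w : Subgroup.center E => w.1.1) h1)
    · right
      exact h2 _ (congrArg (fun w : Subgroup.center E => w.1.1) h1)
  refine ⟨z.1.1, zE, z1, zz, ?_, ?_, comm, cen⟩
  · intro g
    have h1 : g * z.1.1 * g⁻¹ ∈ E := hE.conj_mem _ zE g
    rcases cen _ h1 (fun y hy => by
      have h2 := zc _ (hE.conj_mem y hy g⁻¹)
      have h3 := congrArg (fun t => g * t * g⁻¹) h2
      simp only [inv_inv] at h3
      have e1 : g * (z.1.1 * (g⁻¹ * y * g)) * g⁻¹ = g * z.1.1 * g⁻¹ * y := by group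
      have e2 : g * (g⁻¹ * y * g * z.1.1) * g⁻¹ = y * (g * z.1.1 * g⁻¹) := by group
      rw [← e1, ← e2]
      exact h3) with h2 | h2
    · exact absurd (conj_eq_one_iff.1 h2) z1
    · exact mul_inv_eq_iff_eq_mul.1 h2
  · intro x hx
    refine cen _ (E.mul_mem hx hx) fun y hy => ?_
    rcases comm x hx y hy with h1 | h1
    · rw [mul_assoc, h1, ← mul_assoc, h1, mul_assoc]
    · calc x * x * y = x * (x * y) := mul_assoc _ _ _
        _ = x * (z.1.1 * (y * x)) := by rw [h1]
        _ = z.1.1 * (x * y * x) := by rw [← mul_assoc, ← zc x hx]; simp only [mul_assoc]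
        _ = z.1.1 * z.1.1 * (y * (x * x)) := by rw [h1]; simp only [mul_assoc]
        _ = y * (x * x) := by rw [zz, one_mul]

theorem x17_cenmem {H : Type*} [Group H] [Finite H] (Q : Subgroup H) [hQn : Q.Normal]
    (hH : SimilarToF2Centralizer H Q) {x : H} (h : ∀ y ∈ Q, x * y = y * x) :
    x ∈ Subgroup.center H := by
  rw [← hH.centralizer_eq]
  exact Subgroup.mem_centralizer_iff.2 fun y hy => (h y hy).symm

open scoped commutatorElement in
theorem x17_comm_mem {H : Type*} [Group H] [Finite H] (Q : Subgroup H) [hQn : Q.Normal]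
    (hH : SimilarToF2Centralizer H Q) {x y : H} (hx : x ∈ Q) (hy : y ∈ Q) :
    x * y * x⁻¹ * y⁻¹ ∈ Subgroup.center H := by
  have hm : ⁅(⟨x, hx⟩ : Q), (⟨y, hy⟩ : Q)⁆ ∈ Subgroup.center Q := by
    rw [hH.extraspecial.2.1]
    exact Subgroup.commutator_mem_commutator (Subgroup.mem_top _) (Subgroup.mem_top _)
  refine x17_cenmem Q hH ?_
  intro w hw
  exact (congrArg Subtype.val (Subgroup.mem_center_iff.1 hm ⟨w, hw⟩)).symm

theorem x17_card_center {H : Type*} [Group H] [Finite H] (Q : Subgroup H) [hQn : Q.Normal]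
    (hH : SimilarToF2Centralizer H Q) : Nat.card (Subgroup.center H) = 3 := by
  have h1 : (Subgroup.center Q).map Q.subtype = Subgroup.center H := by
    ext x
    constructor
    · rintro ⟨y, hy, rfl⟩
      refine x17_cenmem Q hH fun w hw => ?_
      exact (congrArg Subtype.val (Subgroup.mem_center_iff.1 hy ⟨w, hw⟩)).symm
    · intro hx
      exact ⟨⟨x, hH.center_le hx⟩, Subgroup.mem_center_iff.2 fun y =>
        Subtype.ext (Subgroup.mem_center_iff.1 hx y.1), rfl⟩
  rw [← h1, ← hH.extraspecial.2.2.2]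
  exact Subgroup.card_map_of_injective Q.subtype_injective

theorem x17_cardG {H : Type*} [Group H] [Finite H] (Q : Subgroup H) [hQn : Q.Normal]
    (hH : SimilarToF2Centralizer H Q) : 2 ^ 13 * 81 * 5 ∣ Nat.card (H ⧸ Q) := by
  obtain ⟨e⟩ := hH.quotient_iso
  rw [Subgroup.card_eq_card_quotient_mul_card_subgroup (Op 2 (H ⧸ Q)), hH.O2_card,
    Nat.card_congr e.toEquiv]
  exact dvd_trans (by norm_num) (mul_dvd_mul_right x17_psp _)

/-- An abelian quotient of `Q` on which `H ⧸ Q` acts. -/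
theorem x17_bridge {H : Type*} [Group H] [Finite H] (Q : Subgroup H) [hQn : Q.Normal]
    (hH : SimilarToF2Centralizer H Q) {V : Type*} [AddCommGroup V] [DistribMulAction (H ⧸ Q) V] (f : Q → V)
    (fmul : ∀ x y, f (x * y) = f x + f y) (fsurj : Function.Surjective f)
    (fker : ∀ x, f x = 0 ↔ x.1 ∈ Subgroup.center H)
    (fact : ∀ (h : H) (x y : Q), h * x.1 * h⁻¹ = y.1 → (QuotientGroup.mk h : H ⧸ Q) • f x = f y)
    (cardV : Nat.card V = 3 ^ 8) :
    ∃ (z : H ⧸ Q) (w : V → V → Additive (Subgroup.center H)), X17Core (Op 2 (H ⧸ Q)) z w := by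
  obtain ⟨z, zE, z1, zz, zc, sq', comm, cen⟩ := x17_E (Op 2 (H ⧸ Q)) hH.O2_extraspecial
  have f1 : f 1 = 0 := (fker 1).2 (Subgroup.one_mem _)
  have finv : ∀ x, f x⁻¹ = - f x := fun x => by
    rw [eq_neg_iff_add_eq_zero, ← fmul, inv_mul_cancel, f1]
  have feq : ∀ x y, f x = f y → ∃ c ∈ Subgroup.center H, x.1 = y.1 * c := by
    intro x y hxy
    refine ⟨(y⁻¹ * x).1, (fker _).1 (by rw [fmul, finv, hxy, neg_add_cancel]), ?_⟩
    change x.1 = y.1 * (y.1⁻¹ * x.1)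
    group
  let s : V → Q := Function.surjInv fsurj
  have hs : ∀ v, f (s v) = v := Function.surjInv_eq fsurj
  let w : V → V → Additive (Subgroup.center H) := fun u v => Additive.ofMul
    ⟨(s u).1 * (s v).1 * (s u).1⁻¹ * (s v).1⁻¹, x17_comm_mem Q hH (s u).2 (s v).2⟩
  have wval : ∀ x y : Q, w (f x) (f y) = Additive.ofMul
      ⟨x.1 * y.1 * x.1⁻¹ * y.1⁻¹, x17_comm_mem Q hH x.2 y.2⟩ := by
    intro x y
    obtain ⟨c, hc, hxc⟩ := feq _ _ (hs (f x))
    obtain ⟨d, hd, hyd⟩ := feq _ _ (hs (f y))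
    refine congrArg Additive.ofMul (Subtype.ext ?_)
    change (s (f x)).1 * (s (f y)).1 * (s (f x)).1⁻¹ * (s (f y)).1⁻¹ = _
    rw [hxc, hyd]
    have hc' := Subgroup.mem_center_iff.1 hc
    have hd' := Subgroup.mem_center_iff.1 hd
    calc x.1 * c * (y.1 * d) * (x.1 * c)⁻¹ * (y.1 * d)⁻¹
        = x.1 * (c * (y.1 * d)) * c⁻¹ * x.1⁻¹ * d⁻¹ * y.1⁻¹ := by group
      _ = x.1 * (y.1 * d * c) * c⁻¹ * x.1⁻¹ * d⁻¹ * y.1⁻¹ := by rw [hc']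
      _ = x.1 * y.1 * (d * x.1⁻¹) * d⁻¹ * y.1⁻¹ := by group
      _ = x.1 * y.1 * (x.1⁻¹ * d) * d⁻¹ * y.1⁻¹ := by rw [hd']
      _ = _ := by group
  have ind : ∀ {p : V → Prop}, (∀ x, p (f x)) → ∀ v, p v := fun h v => by
    obtain ⟨x, rfl⟩ := fsurj v
    exact h x
  have fcomm : ∀ x y : Q, ∀ t : H, t * (x.1 * y.1 * x.1⁻¹ * y.1⁻¹)
      = (x.1 * y.1 * x.1⁻¹ * y.1⁻¹) * t := fun x y =>
    Subgroup.mem_center_iff.1 (x17_comm_mem Q hH x.2 y.2)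
  refine ⟨z, w, ⟨zE, z1, zz, zc, ?_, sq', comm, cen, ?_, ?_, ?_, ?_, ?_, cardV, ?_, ?_, ?_, ?_,
    ?_, ?_⟩⟩
  · intro g x hx
    exact (Op.normal 2 (H ⧸ Q)).conj_mem x hx g
  · exact hH.O2_card
  · intro A hA h2
    exact hH.O2_minusType A hA fun x hx => by rw [pow_two]; exact h2 x hx
  · intro g hg
    exact hH.O2_selfCentralizing (Subgroup.mem_centralizer_iff.2 fun x hx => (hg x hx).symm)
  · exact x17_cardG Q hH
  · refine ind fun x => ?_
    rw [← fmul, ← fmul]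
    have : x * x * x = 1 := Subtype.ext (by
      have := hH.exponent3 x.1 x.2
      rw [pow_succ, pow_two] at this
      exact this)
    rw [this, f1]
  · intro t k htk ht
    obtain ⟨h, rfl⟩ := QuotientGroup.mk_surjective t
    have key : ∀ x ∈ Q, ∃ c ∈ Subgroup.center H, h * x * h⁻¹ = x * c := by
      intro x hx
      have h1 := fact h ⟨x, hx⟩ ⟨h * x * h⁻¹, hQn.conj_mem x hx h⟩ rfl
      rw [ht] at h1
      obtain ⟨c, hc, hxc⟩ := feq _ _ h1.symm
      exact ⟨c, hc, hxc⟩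
    have h3 : h * h * h ∈ Q := by
      apply hH.center_le
      rw [← hH.centralizer_eq]
      refine Subgroup.mem_centralizer_iff.2 fun x hx => ?_
      obtain ⟨c, hc, hxc⟩ := key x hx
      have hc3 := hH.exponent3 c (hH.center_le hc)
      rw [pow_succ, pow_two] at hc3
      have hc' := Subgroup.mem_center_iff.1 hc
      have e1 : h * x = c * (x * h) := by
        rw [← mul_assoc, ← hc', ← hxc]
        group
      have e2 : ∀ y, h * (c * y) = c * (h * y) := fun y => by rw [← mul_assoc, hc', mul_assoc]
      have e3 : ∀ y, h * (x * y) = c * (x * (h * y)) := fun y => by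
        rw [← mul_assoc, e1]
        simp only [mul_assoc]
      symm
      calc h * h * h * x = c * c * c * (x * (h * h * h)) := by simp only [mul_assoc, e1, e2, e3]
        _ = x * (h * h * h) := by rw [hc3, one_mul]
    have t3 : (QuotientGroup.mk h : H ⧸ Q) ^ 3 = 1 := by
      rw [pow_succ, pow_two]
      exact (QuotientGroup.eq_one_iff (h * h * h)).2 h3
    have o1 := orderOf_dvd_of_pow_eq_one t3
    have o2 := orderOf_dvd_of_pow_eq_one htk
    have : Nat.Coprime 3 (2 ^ k) := Nat.Coprime.pow_right k (by norm_num)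
    exact orderOf_eq_one_iff.1 (Nat.eq_one_of_dvd_coprimes this o1 o2)
  · refine ind fun x => ind fun y => ind fun t => ?_
    rw [← fmul, wval, wval, wval, ← ofMul_mul]
    refine congrArg Additive.ofMul (Subtype.ext ?_)
    change x.1 * y.1 * t.1 * (x.1 * y.1)⁻¹ * t.1⁻¹
      = x.1 * t.1 * x.1⁻¹ * t.1⁻¹ * (y.1 * t.1 * y.1⁻¹ * t.1⁻¹)
    calc x.1 * y.1 * t.1 * (x.1 * y.1)⁻¹ * t.1⁻¹
        = x.1 * (y.1 * t.1 * y.1⁻¹ * t.1⁻¹) * (t.1 * x.1⁻¹ * t.1⁻¹) := by group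
      _ = (y.1 * t.1 * y.1⁻¹ * t.1⁻¹) * x.1 * (t.1 * x.1⁻¹ * t.1⁻¹) := by rw [fcomm y t]
      _ = (y.1 * t.1 * y.1⁻¹ * t.1⁻¹) * (x.1 * t.1 * x.1⁻¹ * t.1⁻¹) := by group
      _ = _ := (fcomm y t _).symm
  · refine ind fun x => ind fun y => ind fun t => ?_
    rw [← fmul, wval, wval, wval, ← ofMul_mul]
    refine congrArg Additive.ofMul (Subtype.ext ?_)
    change x.1 * (y.1 * t.1) * x.1⁻¹ * (y.1 * t.1)⁻¹
      = x.1 * y.1 * x.1⁻¹ * y.1⁻¹ * (x.1 * t.1 * x.1⁻¹ * t.1⁻¹)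
    calc x.1 * (y.1 * t.1) * x.1⁻¹ * (y.1 * t.1)⁻¹
        = x.1 * y.1 * x.1⁻¹ * ((x.1 * t.1 * x.1⁻¹ * t.1⁻¹) * y.1⁻¹) := by group
      _ = _ := by rw [← fcomm x t]; group
  · refine ind fun x => ?_
    rw [wval]
    refine congrArg Additive.ofMul (Subtype.ext ?_)
    change x.1 * x.1 * x.1⁻¹ * x.1⁻¹ = 1
    group
  · intro g
    refine ind fun x => ind fun y => ?_
    obtain ⟨h, rfl⟩ := QuotientGroup.mk_surjective g
    rw [fact h x ⟨_, hQn.conj_mem _ x.2 h⟩ rfl, fact h y ⟨_, hQn.conj_mem _ y.2 h⟩ rfl, wval, wval]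
    refine congrArg Additive.ofMul (Subtype.ext ?_)
    change h * x.1 * h⁻¹ * (h * y.1 * h⁻¹) * (h * x.1 * h⁻¹)⁻¹ * (h * y.1 * h⁻¹)⁻¹
      = x.1 * y.1 * x.1⁻¹ * y.1⁻¹
    calc _ = h * (x.1 * y.1 * x.1⁻¹ * y.1⁻¹) * h⁻¹ := by group
      _ = _ := by rw [fcomm x y]; group
  · refine ind fun x => ?_
    intro hx
    by_contra hcon
    push Not at hcon
    apply hx
    rw [fker]
    refine x17_cenmem Q hH fun y hy => ?_
    have h1 := hcon (f ⟨y, hy⟩)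
    rw [wval] at h1
    have h2 : x.1 * y * x.1⁻¹ * y⁻¹ = 1 := congrArg (fun a => (Additive.toMul a).1) h1
    rw [mul_inv_eq_one, mul_inv_eq_iff_eq_mul] at h2
    exact h2

theorem x17_V {H : Type u} [Group H] [Finite H] (Q : Subgroup H) [hQn : Q.Normal]
    (hH : SimilarToF2Centralizer H Q) : ∃ (V : Type u) (_ : AddCommGroup V) (_ : DistribMulAction (H ⧸ Q) V) (_ : Finite V)
    (f : Q → V), (∀ x y, f (x * y) = f x + f y) ∧ Function.Surjective f ∧
    (∀ x, f x = 0 ↔ x.1 ∈ Subgroup.center H) ∧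
    (∀ (h : H) (x y : Q), h * x.1 * h⁻¹ = y.1 → (QuotientGroup.mk h : H ⧸ Q) • f x = f y) ∧
    Nat.card V = 3 ^ 8 := by
  let Z : Subgroup Q := (Subgroup.center H).subgroupOf Q
  have hcard : Nat.card (Q ⧸ Z) = 3 ^ 8 := by
    have h1 := Subgroup.card_eq_card_quotient_mul_card_subgroup Z
    have h2 : Nat.card Z = 3 := by
      rw [← x17_card_center Q hH]
      exact Nat.card_congr (Subgroup.subgroupOfEquivOfLe hH.center_le).toEquiv
    rw [h2, hH.card_eq] at h1
    omega
  let I : CommGroup (Q ⧸ Z) :=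
    { (inferInstance : Group (Q ⧸ Z)) with
      mul_comm := by
        intro a b
        obtain ⟨x, rfl⟩ := QuotientGroup.mk_surjective a
        obtain ⟨y, rfl⟩ := QuotientGroup.mk_surjective b
        refine QuotientGroup.eq.2 ?_
        change ((x * y)⁻¹ * (y * x)).1 ∈ Subgroup.center H
        have := x17_comm_mem Q hH (Q.inv_mem y.2) (Q.inv_mem x.2)
        convert this using 1
        change (x.1 * y.1)⁻¹ * (y.1 * x.1) = _
        group }
  let f : Q → Additive (Q ⧸ Z) := fun x => Additive.ofMul (QuotientGroup.mk x)
  have fsurj : Function.Surjective f := fun v => QuotientGroup.mk_surjective (Additive.toMul v)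
  have fmul : ∀ x y, f (x * y) = f x + f y := fun x y => rfl
  have feq : ∀ x y, f x = f y ↔ x.1⁻¹ * y.1 ∈ Subgroup.center H := fun x y =>
    QuotientGroup.eq (s := Z)
  let s : Additive (Q ⧸ Z) → Q := Function.surjInv fsurj
  have hs : ∀ v, f (s v) = v := Function.surjInv_eq fsurj
  let act : H ⧸ Q → Additive (Q ⧸ Z) → Additive (Q ⧸ Z) := fun g v =>
    f ⟨g.out * (s v).1 * g.out⁻¹, hQn.conj_mem _ (s v).2 _⟩
  have hact : ∀ (h : H) (x y : Q), h * x.1 * h⁻¹ = y.1 →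
      act (QuotientGroup.mk h : H ⧸ Q) (f x) = f y := by
    intro h x y hxy
    obtain ⟨q, hq⟩ := QuotientGroup.mk_out_eq_mul Q h
    refine (feq _ _).2 ?_
    change ((QuotientGroup.mk h : H ⧸ Q).out * (s (f x)).1 * (QuotientGroup.mk h : H ⧸ Q).out⁻¹)⁻¹
      * y.1 ∈ _
    rw [hq, ← hxy]
    have hc := (feq _ _).1 (hs (f x))
    have hd := x17_comm_mem Q hH q.2 (Q.inv_mem (s (f x)).2)
    have he := (Subgroup.center H).mul_mem hd hc
    have := (inferInstance : (Subgroup.center H).Normal).conj_mem _ he h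
    convert this using 1
    group
  have fout : ∀ g : H ⧸ Q, ∃ h : H, QuotientGroup.mk h = g := QuotientGroup.mk_surjective
  let J : DistribMulAction (H ⧸ Q) (Additive (Q ⧸ Z)) :=
    { smul := act
      one_smul := by
        intro v
        obtain ⟨x, rfl⟩ := fsurj v
        exact hact 1 x x (by group)
      mul_smul := by
        intro g k v
        obtain ⟨x, rfl⟩ := fsurj v
        obtain ⟨g, rfl⟩ := fout g
        obtain ⟨k, rfl⟩ := fout k
        have h1 := hact k x ⟨_, hQn.conj_mem _ x.2 k⟩ rfl
        have h2 := hact g ⟨_, hQn.conj_mem _ x.2 k⟩ ⟨_, hQn.conj_mem _ (hQn.conj_mem _ x.2 k) g⟩ rfl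
        have h3 := hact (g * k) x ⟨_, hQn.conj_mem _ (hQn.conj_mem _ x.2 k) g⟩
          (by simp only [mul_inv_rev, mul_assoc])
        change act _ _ = act _ (act _ _)
        rw [h1, h2]
        exact h3
      smul_zero := by
        intro g
        obtain ⟨g, rfl⟩ := fout g
        exact hact g 1 1 (by simp)
      smul_add := by
        intro g u v
        obtain ⟨g, rfl⟩ := fout g
        obtain ⟨x, rfl⟩ := fsurj u
        obtain ⟨y, rfl⟩ := fsurj v
        change act _ _ = act _ _ + act _ _
        rw [hact g x ⟨_, hQn.conj_mem _ x.2 g⟩ rfl, hact g y ⟨_, hQn.conj_mem _ y.2 g⟩ rfl,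
          ← fmul, ← fmul]
        refine hact g _ _ ?_
        change g * (x.1 * y.1) * g⁻¹ = g * x.1 * g⁻¹ * (g * y.1 * g⁻¹)
        group }
  refine ⟨Additive (Q ⧸ Z), inferInstance, J, inferInstanceAs (Finite (Q ⧸ Z)), f, fmul, fsurj, ?_,
    hact, hcard⟩
  intro x
  have h1 := feq 1 x
  simp only [Subgroup.coe_one, inv_one, one_mul] at h1
  rw [← h1]
  exact eq_comm

theorem x17_lift {H : Type*} [Group H] [Finite H] (Q : Subgroup H) [hQn : Q.Normal]
    (hH : SimilarToF2Centralizer H Q) {a x : H} (hx : x ∈ Q) (hxc : x ∉ Subgroup.center H)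
    (h : H) (hc : (h * a * h⁻¹)⁻¹ * x ∈ Subgroup.center H) : ∃ k : H, k * a * k⁻¹ = x := by
  have hfc := x17_card_center Q hH
  let D : Q →* Subgroup.center H :=
    { toFun := fun y => ⟨y.1 * x * y.1⁻¹ * x⁻¹, x17_comm_mem Q hH y.2 hx⟩
      map_one' := Subtype.ext (by simp)
      map_mul' := fun y t => Subtype.ext (by
        change y.1 * t.1 * x * (y.1 * t.1)⁻¹ * x⁻¹
          = y.1 * x * y.1⁻¹ * x⁻¹ * (t.1 * x * t.1⁻¹ * x⁻¹)
        have := Subgroup.mem_center_iff.1 (x17_comm_mem Q hH t.2 hx)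
        calc y.1 * t.1 * x * (y.1 * t.1)⁻¹ * x⁻¹
            = y.1 * (t.1 * x * t.1⁻¹ * x⁻¹) * (x * y.1⁻¹ * x⁻¹) := by group
          _ = (t.1 * x * t.1⁻¹ * x⁻¹) * y.1 * (x * y.1⁻¹ * x⁻¹) := by rw [this]
          _ = (t.1 * x * t.1⁻¹ * x⁻¹) * (y.1 * x * y.1⁻¹ * x⁻¹) := by group
          _ = _ := (this _).symm) }
  have : Fact (Nat.Prime 3) := ⟨Nat.prime_three⟩
  have hD : D.range = ⊤ := by
    have : Fact (Nat.Prime (Nat.card (Subgroup.center H))) := by rw [hfc]; infer_instance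
    rcases Subgroup.eq_bot_or_eq_top_of_prime_card D.range with h1 | h1
    · exfalso
      apply hxc
      refine x17_cenmem Q hH fun y hy => ?_
      have h2 : D ⟨y, hy⟩ = 1 := by
        have : D ⟨y, hy⟩ ∈ D.range := ⟨_, rfl⟩
        rw [h1] at this
        exact this
      have h3 : y * x * y⁻¹ * x⁻¹ = 1 := congrArg Subtype.val h2
      rw [mul_inv_eq_one, mul_inv_eq_iff_eq_mul] at h3
      exact h3.symm
    · exact h1
  obtain ⟨y, hy⟩ : (⟨_, hc⟩ : Subgroup.center H) ∈ D.range := by rw [hD]; trivial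
  have h1 : y.1 * x * y.1⁻¹ * x⁻¹ = (h * a * h⁻¹)⁻¹ * x := congrArg Subtype.val hy
  have hcc := Subgroup.mem_center_iff.1 hc
  refine ⟨y.1 * h, ?_⟩
  generalize hcd : (h * a * h⁻¹)⁻¹ * x = c at *
  have h2 : h * a * h⁻¹ = x * c⁻¹ := by rw [← hcd]; group
  have h3 : y.1 * x * y.1⁻¹ = c * x := by rw [← h1]; group
  calc y.1 * h * a * (y.1 * h)⁻¹ = y.1 * (h * a * h⁻¹) * y.1⁻¹ := by group
    _ = y.1 * x * (c⁻¹ * y.1⁻¹) := by rw [h2]; group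
    _ = y.1 * x * (y.1 * c)⁻¹ := by group
    _ = y.1 * x * (c * y.1)⁻¹ := by rw [hcc]
    _ = (y.1 * x * y.1⁻¹) * c⁻¹ := by group
    _ = c * x * c⁻¹ := by rw [h3]
    _ = x := by rw [← hcc]; group


/-- **Lemma 4.8(i).** Let `H` be similar to a 3-centralizer in a group of type `F₂` with
`Q = O₃(H)` and `Z = Z(Q) = Z(H)`.  Then the conjugation action of `H` on `Q ∖ Z` has
exactly two orbits. -/
theorem stmt_17 {H : Type*} [Group H] [Finite H] (Q : Subgroup H) [Q.Normal]
    (hH : SimilarToF2Centralizer H Q) :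
    ∃ a b : H, a ∈ Q ∧ b ∈ Q ∧ a ∉ Subgroup.center H ∧ b ∉ Subgroup.center H ∧
      (¬ ∃ h : H, h * a * h⁻¹ = b) ∧
      ∀ x ∈ Q, x ∉ Subgroup.center H →
        ((∃ h : H, h * a * h⁻¹ = x) ∨ ∃ h : H, h * b * h⁻¹ = x) := by
  obtain ⟨V, i1, i2, i3, f, fmul, fsurj, fker, fact, cardV⟩ := x17_V Q hH
  obtain ⟨z, w, hcore⟩ := x17_bridge Q hH f fmul fsurj fker fact cardV
  obtain ⟨a, b, ha, hb, hab, hall⟩ := hcore.main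
  obtain ⟨a, rfl⟩ := fsurj a
  obtain ⟨b, rfl⟩ := fsurj b
  have lift : ∀ (c : Q) (x : H) (hx : x ∈ Q), x ∉ Subgroup.center H →
      (∃ g : H ⧸ Q, g • f c = f ⟨x, hx⟩) → ∃ h : H, h * c.1 * h⁻¹ = x := by
    rintro c x hx hxc ⟨g, hg⟩
    obtain ⟨h, rfl⟩ := QuotientGroup.mk_surjective g
    have hm : h * c.1 * h⁻¹ ∈ Q := Subgroup.Normal.conj_mem inferInstance _ c.2 h
    rw [fact h c ⟨_, hm⟩ rfl] at hg
    refine x17_lift Q hH hx hxc h ?_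
    have h1 : f (⟨_, hm⟩⁻¹ * ⟨x, hx⟩) = 0 := by
      rw [fmul, ← hg, ← fmul, inv_mul_cancel]
      exact (fker 1).2 (Subgroup.one_mem _)
    exact (fker _).1 h1
  refine ⟨a, b, a.2, b.2, fun h => ha ((fker a).2 h), fun h => hb ((fker b).2 h), ?_, ?_⟩
  · rintro ⟨h, hh⟩
    exact hab ⟨_, fact h a b hh⟩
  · intro x hx hxc
    rcases hall (f ⟨x, hx⟩) (fun h => hxc ((fker _).1 h)) with h1 | h1
    · exact Or.inl (lift a x hx hxc h1)
    · exact Or.inr (lift b x hx hxc h1)
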